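/- Let p ∈ (1,∞) and let R = ∏_{i=1}^n (a_i,b_i) with −∞ < a_i < b_i < ∞. Then u(x) = ∏_{i=1}^n sin_p(π_p (x_i − a_i)/(b_i − a_i)) is a first eigenfunction of the pseudo-p-Laplacian with Dirichlet boundary conditions on R, i.e., a minimizer of the Rayleigh quotient ‖|∇v|_{ℓ^p}‖_{L^p(R)}^p / ‖v‖_{L^p(R)}^p over nonzero v ∈ W_0^{1,p}(R), and it satisfies Δ̃_p u = λ̃_p |u|^{p−2} u in R with u = 0 on ∂R, where λ̃_p = π_p^p (p−1) Σ_{i=1}^n (b_i − a_i)^{−p} and Δ̃_p u = Σ_{i=1}^n ∂/∂x_i (|∂u/∂x_i|^{p−2} ∂u/∂x_i). -/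

import Mathlib

open MeasureTheory ENNReal Set Filter Topology

noncomputable section

/-- The `i`-th partial derivative of `u : ℝⁿ → ℝ`. -/
def pder {n : ℕ} (i : Fin n) (u : (Fin n → ℝ) → ℝ) (x : Fin n → ℝ) : ℝ :=
  fderiv ℝ u x (Pi.single i 1)

/-- `u` is a smooth function compactly supported in the open set `D`. -/
def IsTestFun {n : ℕ} (D : Set (Fin n → ℝ)) (u : (Fin n → ℝ) → ℝ) : Prop :=
  ContDiff ℝ (⊤ : ℕ∞) u ∧ HasCompactSupport u ∧ tsupport u ⊆ D

/-- The strip-like domain `ℝᵏ × ∏_{i ≥ k} (aᵢ, bᵢ)`, realized as a subset of `ℝⁿ`: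
the coordinates `i < k` are free, the coordinates `i ≥ k` are constrained to `(aᵢ, bᵢ)`. -/
def stripDomain (n k : ℕ) (a b : Fin n → ℝ) : Set (Fin n → ℝ) :=
  {x | ∀ i : Fin n, k ≤ (i : ℕ) → x i ∈ Set.Ioo (a i) (b i)}

/-- The ambient space `V = L^p(ℝⁿ; ℓ^p(ℝ^{n+1}))`, in which the Sobolev space `W^{1,p}_0`
is realized as the closure of the set of "jets" `(u, ∇u)` of test functions. -/
abbrev Vsp (n : ℕ) (p : ℝ≥0∞) [Fact (1 ≤ p)] :=
  Lp (PiLp p (fun _ : Fin (n + 1) => ℝ)) p (volume : Measure (Fin n → ℝ))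

/-- The "jet" `(u, ∂₁u, …, ∂ₙu)` of a function, valued in `ℓ^p(ℝ^{n+1})`. -/
def jet {n : ℕ} (p : ℝ≥0∞) (u : (Fin n → ℝ) → ℝ) (x : Fin n → ℝ) :
    PiLp p (fun _ : Fin (n + 1) => ℝ) :=
  (WithLp.equiv p (∀ _ : Fin (n + 1), ℝ)).symm (Fin.cons (u x) (fun i => pder i u x))

/-- `W^{1,p}_0(D)` realized as a closed subspace of `V`:
the closure of the subspace of jets of test functions supported in `D`.
The (subspace) norm of the jet of `u` is exactly
`(‖u‖_p^p + ‖ |∇u|_{ℓ^p} ‖_p^p)^{1/p}`, i.e., the `W^{1,p}`-norm of `u`. -/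
def W0sub {n : ℕ} (p : ℝ≥0∞) [Fact (1 ≤ p)] (D : Set (Fin n → ℝ)) : Submodule ℝ (Vsp n p) :=
  (Submodule.span ℝ {f : Vsp n p | ∃ u : (Fin n → ℝ) → ℝ, IsTestFun D u ∧
    (f : (Fin n → ℝ) → PiLp p (fun _ : Fin (n + 1) => ℝ)) =ᵐ[volume] jet p u}).topologicalClosure

instance W0sub.completeSpace {n : ℕ} (p : ℝ≥0∞) [Fact (1 ≤ p)] (D : Set (Fin n → ℝ)) :
    CompleteSpace (W0sub (n := n) p D) :=
  (Submodule.isClosed_topologicalClosure _).completeSpace_coe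

/-- Projection of a jet onto its zeroth (function) component. -/
def proj0 (n : ℕ) (p : ℝ≥0∞) [Fact (1 ≤ p)] : PiLp p (fun _ : Fin (n + 1) => ℝ) →L[ℝ] ℝ :=
  (ContinuousLinearMap.proj (0 : Fin (n + 1))).comp
    (PiLp.continuousLinearEquiv p ℝ (fun _ : Fin (n + 1) => ℝ)).toContinuousLinearMap

/-- Projection of a jet onto its gradient components, valued in `ℓ^p(ℝⁿ)`. -/
def projGrad (n : ℕ) (p : ℝ≥0∞) [Fact (1 ≤ p)] :
    PiLp p (fun _ : Fin (n + 1) => ℝ) →L[ℝ] PiLp p (fun _ : Fin n => ℝ) :=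
  ((PiLp.continuousLinearEquiv p ℝ (fun _ : Fin n => ℝ)).symm.toContinuousLinearMap).comp
    ((ContinuousLinearMap.pi fun i : Fin n => ContinuousLinearMap.proj (R := ℝ) i.succ).comp
      (PiLp.continuousLinearEquiv p ℝ (fun _ : Fin (n + 1) => ℝ)).toContinuousLinearMap)

/-- The canonical Sobolev embedding `I : W^{1,p}_0(D) → L^p(D)` (as a map into `L^p(ℝⁿ)`;
all functions in `W^{1,p}_0(D)` vanish a.e. outside `D`). -/
def SobolevEmb {n : ℕ} (p : ℝ≥0∞) [Fact (1 ≤ p)] (D : Set (Fin n → ℝ)) :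
    W0sub (n := n) p D →L[ℝ] Lp ℝ p (volume : Measure (Fin n → ℝ)) :=
  ((proj0 n p).compLpL p volume).comp (W0sub p D).subtypeL

/-- The gradient map `W^{1,p}_0(D) → L^p(D; ℓ^p(ℝⁿ))`, `u ↦ ∇u`. -/
def SobolevGrad {n : ℕ} (p : ℝ≥0∞) [Fact (1 ≤ p)] (D : Set (Fin n → ℝ)) :
    W0sub (n := n) p D →L[ℝ] Lp (PiLp p (fun _ : Fin n => ℝ)) p (volume : Measure (Fin n → ℝ)) :=
  ((projGrad n p).compLpL p volume).comp (W0sub p D).subtypeL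

/-- `π_p = 2 ∫₀¹ (1 - sᵖ)^{-1/p} ds`. -/
def piP (p : ℝ) : ℝ := 2 * ∫ s in (0 : ℝ)..1, (1 - s ^ p) ^ (-1 / p)

/-- The inverse of `t ↦ ∫₀ᵗ (1 - sᵖ)^{-1/p} ds` on `[0,1]`; this is `sin_p` on `[0, π_p/2]`. -/
def sinpHalf (p : ℝ) : ℝ → ℝ :=
  Function.invFunOn (fun t : ℝ => ∫ s in (0 : ℝ)..t, (1 - s ^ p) ^ (-1 / p)) (Set.Icc 0 1)

/-- `sin_p` on `[0, π_p]`, by reflection around `π_p/2`. -/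
def sinpBase (p t : ℝ) : ℝ :=
  if t ≤ piP p / 2 then sinpHalf p t else sinpHalf p (piP p - t)

/-- `sin_p` on `[-π_p, π_p]`, by odd reflection. -/
def sinpSym (p t : ℝ) : ℝ := if 0 ≤ t then sinpBase p t else -sinpBase p (-t)

/-- The generalized sine function `sin_p`, extended `2π_p`-periodically to all of `ℝ`. -/
def sinp (p t : ℝ) : ℝ :=
  sinpSym p (t - 2 * piP p * ⌊(t + piP p) / (2 * piP p)⌋)

/-- The generalized cosine function `cos_p = (sin_p)'`. -/
def cosp (p : ℝ) : ℝ → ℝ := deriv (sinp p)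

/-- The `m`-th entropy number of a bounded linear operator: the infimum of all `ε > 0` such
that the image of the closed unit ball can be covered by `2^{m-1}` balls of radius `ε`. -/
def entropyNumber {X Y : Type*} [NormedAddCommGroup X] [NormedSpace ℝ X]
    [NormedAddCommGroup Y] [NormedSpace ℝ Y] (m : ℕ) (T : X →L[ℝ] Y) : ℝ :=
  sInf {ε : ℝ | 0 < ε ∧ ∃ c : Fin (2 ^ (m - 1)) → Y,
    ∀ x : X, ‖x‖ ≤ 1 → ∃ j, ‖T x - c j‖ ≤ ε}

end

theorem hasDerivAt_of_eventually_hasDerivAt_of_tendsto {f g : ℝ → ℝ} {x : ℝ}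
    (f_diff : ∀ᶠ y in 𝓝[≠] x, HasDerivAt f (g y) y) (hf : ContinuousAt f x)
    (hg : ContinuousAt g x) : HasDerivAt f (g x) x := by
  have hs : {y | HasDerivAt f (g y) y} ∈ 𝓝[≠] x := f_diff
  have hr : {y | HasDerivAt f (g y) y} ∈ 𝓝[>] x :=
    nhdsWithin_mono x (fun y hy => ne_of_gt hy) hs
  have hl : {y | HasDerivAt f (g y) y} ∈ 𝓝[<] x :=
    nhdsWithin_mono x (fun y hy => ne_of_lt hy) hs
  have diff : DifferentiableOn ℝ f {y | HasDerivAt f (g y) y} :=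
    fun y hy => (show HasDerivAt f (g y) y from hy).differentiableAt.differentiableWithinAt
  have A : HasDerivWithinAt f (g x) (Ici x) x := by
    refine hasDerivWithinAt_Ici_of_tendsto_deriv diff hf.continuousWithinAt hr ?_
    refine (tendsto_inf_left hg : Tendsto g (𝓝[>] x) (𝓝 (g x))).congr' ?_
    filter_upwards [hr] with y hy using (show HasDerivAt f (g y) y from hy).deriv.symm
  have B : HasDerivWithinAt f (g x) (Iic x) x := by
    refine hasDerivWithinAt_Iic_of_tendsto_deriv diff hf.continuousWithinAt hl ?_
    refine (tendsto_inf_left hg : Tendsto g (𝓝[<] x) (𝓝 (g x))).congr' ?_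
    filter_upwards [hl] with y hy using (show HasDerivAt f (g y) y from hy).deriv.symm
  simpa using B.union A

/-- The generalized arcsine, whose inverse is `sinpHalf`. -/
noncomputable def arcsinp (p t : ℝ) : ℝ := ∫ s in (0 : ℝ)..t, (1 - s ^ p) ^ (-1 / p)

section SinP

variable {p : ℝ}

theorem one_sub_rpow_pos (hp : 1 < p) {s : ℝ} (hs : s ∈ Ico (0 : ℝ) 1) : 0 < 1 - s ^ p := by
  have := Real.rpow_lt_one hs.1 hs.2 (by linarith : 0 < p)
  linarith

theorem intervalIntegrable_arcsinp (hp : 1 < p) :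
    IntervalIntegrable (fun s : ℝ => (1 - s ^ p) ^ (-1 / p)) volume 0 1 := by
  have h1 : (-1 : ℝ) < -1 / p := by
    rw [neg_div, neg_lt_neg_iff, div_lt_one (by linarith)]; exact hp
  have h2 : IntervalIntegrable (fun s : ℝ => (1 - s) ^ (-1 / p)) volume 0 1 := by
    have := (intervalIntegral.intervalIntegrable_rpow' (a := 1) (b := 0) h1).comp_sub_left 1
    simpa using this
  refine h2.mono_fun (Measurable.aestronglyMeasurable (by fun_prop)) ?_
  refine (ae_restrict_mem measurableSet_uIoc).mono fun s hs => ?_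
  rw [uIoc_of_le zero_le_one] at hs
  rcases hs.2.eq_or_lt with rfl | h
  · simp
  have h3 := one_sub_rpow_pos hp ⟨hs.1.le, h⟩
  have h4 : s ^ p ≤ s := by
    have := Real.rpow_le_rpow_of_exponent_ge hs.1 hs.2 hp.le
    simpa using this
  dsimp only
  rw [Real.norm_of_nonneg (Real.rpow_nonneg h3.le _),
    Real.norm_of_nonneg (Real.rpow_nonneg (by linarith) _)]
  exact Real.rpow_le_rpow_of_nonpos (by linarith) (by linarith)
    (div_nonpos_of_nonpos_of_nonneg (by norm_num) (by linarith))

theorem intervalIntegrable_arcsinp_sub (hp : 1 < p) {x y : ℝ} (hx : 0 ≤ x) (hxy : x ≤ y)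
    (hy : y ≤ 1) :
    IntervalIntegrable (fun s : ℝ => (1 - s ^ p) ^ (-1 / p)) volume x y :=
  (intervalIntegrable_arcsinp hp).mono_set (by
    rw [uIcc_of_le hxy, uIcc_of_le zero_le_one]; exact Icc_subset_Icc hx hy)

theorem sub_le_arcsinp_sub (hp : 1 < p) {x y : ℝ} (hx : 0 ≤ x) (hxy : x ≤ y) (hy : y ≤ 1) :
    y - x ≤ arcsinp p y - arcsinp p x := by
  unfold arcsinp
  rw [intervalIntegral.integral_interval_sub_left
    (intervalIntegrable_arcsinp_sub hp le_rfl (hx.trans hxy) hy)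
    (intervalIntegrable_arcsinp_sub hp le_rfl hx (hxy.trans hy))]
  have : y - x = ∫ _ in x..y, (1 : ℝ) := by simp
  rw [this]
  refine intervalIntegral.integral_mono_on_of_le_Ioo hxy (by simp)
    (intervalIntegrable_arcsinp_sub hp hx hxy hy) fun s hs => ?_
  have h0 : 0 < s := hx.trans_lt hs.1
  have h3 := one_sub_rpow_pos hp ⟨h0.le, hs.2.trans_le hy⟩
  refine Real.one_le_rpow_of_pos_of_le_one_of_nonpos h3 ?_
    (div_nonpos_of_nonpos_of_nonneg (by norm_num) (by linarith))
  have := Real.rpow_nonneg h0.le p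
  linarith

theorem arcsinp_zero : arcsinp p 0 = 0 := by simp [arcsinp]

theorem arcsinp_one : arcsinp p 1 = piP p / 2 := by simp [arcsinp, piP]

theorem piP_pos (hp : 1 < p) : 0 < piP p := by
  have := sub_le_arcsinp_sub hp le_rfl zero_le_one le_rfl
  rw [arcsinp_zero, arcsinp_one] at this
  linarith

theorem continuousOn_arcsinp (hp : 1 < p) : ContinuousOn (arcsinp p) (Icc 0 1) := by
  have := intervalIntegral.continuousOn_primitive_interval'
    (intervalIntegrable_arcsinp hp) (a := 0) (by simp)
  rwa [uIcc_of_le zero_le_one] at this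

theorem sinpHalf_spec (hp : 1 < p) {y : ℝ} (hy : y ∈ Icc 0 (piP p / 2)) :
    sinpHalf p y ∈ Icc (0 : ℝ) 1 ∧ arcsinp p (sinpHalf p y) = y := by
  have : y ∈ arcsinp p '' Icc 0 1 := by
    have h := intermediate_value_Icc zero_le_one (continuousOn_arcsinp hp)
    rw [arcsinp_zero, arcsinp_one] at h
    exact h hy
  exact Function.invFunOn_pos this

theorem arcsinp_mono (hp : 1 < p) {x y : ℝ} (hx : x ∈ Icc (0 : ℝ) 1) (hy : y ∈ Icc (0 : ℝ) 1) :
    arcsinp p x ≤ arcsinp p y ↔ x ≤ y := by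
  constructor
  · intro h
    by_contra! h'
    have := sub_le_arcsinp_sub hp hy.1 h'.le hx.2
    linarith
  · intro h
    have := sub_le_arcsinp_sub hp hx.1 h hy.2
    linarith

theorem sinpHalf_arcsinp (hp : 1 < p) {x : ℝ} (hx : x ∈ Icc (0 : ℝ) 1) :
    sinpHalf p (arcsinp p x) = x := by
  have hpi := piP_pos hp
  have h : arcsinp p x ∈ Icc 0 (piP p / 2) := by
    rw [← arcsinp_zero (p := p), ← arcsinp_one]
    exact ⟨(arcsinp_mono hp (by simp) hx).2 hx.1, (arcsinp_mono hp hx (by simp)).2 hx.2⟩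
  obtain ⟨h1, h2⟩ := sinpHalf_spec hp h
  exact le_antisymm ((arcsinp_mono hp h1 hx).1 h2.le) ((arcsinp_mono hp hx h1).1 h2.ge)

theorem sinpHalf_zero (hp : 1 < p) : sinpHalf p 0 = 0 := by
  have := sinpHalf_arcsinp hp (x := 0) (by simp)
  rwa [arcsinp_zero] at this

theorem sinpHalf_pi_div_two (hp : 1 < p) : sinpHalf p (piP p / 2) = 1 := by
  have := sinpHalf_arcsinp hp (x := 1) (by simp)
  rwa [arcsinp_one] at this

theorem sinpHalf_sub_le (hp : 1 < p) {y z : ℝ} (hy : y ∈ Icc 0 (piP p / 2))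
    (hz : z ∈ Icc 0 (piP p / 2)) :
    |sinpHalf p y - sinpHalf p z| ≤ |y - z| := by
  obtain ⟨h1, h2⟩ := sinpHalf_spec hp hy
  obtain ⟨h3, h4⟩ := sinpHalf_spec hp hz
  rcases le_total (sinpHalf p y) (sinpHalf p z) with h | h
  · have := sub_le_arcsinp_sub hp h1.1 h h3.2
    rw [h2, h4] at this
    rw [abs_of_nonpos (by linarith), abs_of_nonpos (by linarith)]
    linarith
  · have := sub_le_arcsinp_sub hp h3.1 h h1.2
    rw [h2, h4] at this
    rw [abs_of_nonneg (by linarith), abs_of_nonneg (by linarith)]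
    linarith

theorem continuousOn_sinpHalf (hp : 1 < p) : ContinuousOn (sinpHalf p) (Icc 0 (piP p / 2)) := by
  have : LipschitzOnWith 1 (sinpHalf p) (Icc 0 (piP p / 2)) :=
    LipschitzOnWith.of_dist_le_mul fun x hx y hy => by
      simpa [Real.dist_eq] using sinpHalf_sub_le hp hx hy
  exact this.continuousOn

theorem sinpHalf_mem_Ioo (hp : 1 < p) {y : ℝ} (hy : y ∈ Ioo 0 (piP p / 2)) :
    sinpHalf p y ∈ Ioo (0 : ℝ) 1 := by
  obtain ⟨h1, h2⟩ := sinpHalf_spec hp ⟨hy.1.le, hy.2.le⟩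
  refine ⟨lt_of_le_of_ne h1.1 fun h => ?_, lt_of_le_of_ne h1.2 fun h => ?_⟩
  · rw [← h, arcsinp_zero] at h2
    exact hy.1.ne h2
  · rw [h, arcsinp_one] at h2
    exact hy.2.ne h2.symm

theorem hasDerivAt_arcsinp (hp : 1 < p) {x : ℝ} (hx : x ∈ Ioo (0 : ℝ) 1) :
    HasDerivAt (arcsinp p) ((1 - x ^ p) ^ (-1 / p)) x := by
  have h3 := one_sub_rpow_pos hp ⟨hx.1.le, hx.2⟩
  refine intervalIntegral.integral_hasDerivAt_right
    (intervalIntegrable_arcsinp_sub hp le_rfl hx.1.le hx.2.le) ?_ ?_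
  · exact (Measurable.stronglyMeasurable (by fun_prop)).stronglyMeasurableAtFilter
  · refine ContinuousAt.rpow_const ?_ (Or.inl h3.ne')
    exact continuousAt_const.sub (continuousAt_id.rpow_const (Or.inl hx.1.ne'))

theorem hasDerivAt_sinpHalf (hp : 1 < p) {y : ℝ} (hy : y ∈ Ioo 0 (piP p / 2)) :
    HasDerivAt (sinpHalf p) ((1 - sinpHalf p y ^ p) ^ (1 / p)) y := by
  have hx := sinpHalf_mem_Ioo hp hy
  have h3 := one_sub_rpow_pos hp ⟨hx.1.le, hx.2⟩
  have hd := HasDerivAt.of_local_left_inverse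
    ((continuousOn_sinpHalf hp).continuousAt (Icc_mem_nhds hy.1 hy.2))
    (hasDerivAt_arcsinp hp hx) (Real.rpow_pos_of_pos h3 _).ne' (by
      filter_upwards [Icc_mem_nhds hy.1 hy.2] with z hz using (sinpHalf_spec hp hz).2)
  rwa [← Real.rpow_neg h3.le, neg_div, neg_neg] at hd

theorem sinp_of_le (hp : 1 < p) {t : ℝ} (ht : t ∈ Icc 0 (piP p / 2)) : sinp p t = sinpHalf p t := by
  have hpi := piP_pos hp
  have hfl : ⌊(t + piP p) / (2 * piP p)⌋ = 0 := by
    rw [Int.floor_eq_zero_iff]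
    refine ⟨div_nonneg (by linarith [ht.1]) (by linarith), ?_⟩
    rw [div_lt_one (by linarith)]
    linarith [ht.2]
  simp [sinp, hfl, sinpSym, sinpBase, ht.1, ht.2]

theorem sinp_of_ge (hp : 1 < p) {t : ℝ} (ht : t ∈ Ico (piP p / 2) (piP p)) :
    sinp p t = sinpHalf p (piP p - t) := by
  have hpi := piP_pos hp
  have h0 : 0 ≤ t := by linarith [ht.1]
  have hfl : ⌊(t + piP p) / (2 * piP p)⌋ = 0 := by
    rw [Int.floor_eq_zero_iff]
    refine ⟨div_nonneg (by linarith [ht.1]) (by linarith), ?_⟩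
    rw [div_lt_one (by linarith)]
    linarith [ht.2]
  rcases ht.1.eq_or_lt with h | h
  · subst h
    simp only [sinp, hfl, sinpSym, sinpBase]
    simp [h0]
    congr 1
    ring
  · simp [sinp, hfl, sinpSym, sinpBase, h0, h]

theorem sinp_zero (hp : 1 < p) : sinp p 0 = 0 := by
  rw [sinp_of_le hp ⟨le_rfl, by linarith [piP_pos hp]⟩, sinpHalf_zero hp]

theorem sinp_pi (hp : 1 < p) : sinp p (piP p) = 0 := by
  have hpi := piP_pos hp
  have hfl : ⌊(piP p + piP p) / (2 * piP p)⌋ = 1 := by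
    rw [← two_mul, div_self (by linarith)]; simp
  have e : piP p - 2 * piP p * ((1 : ℤ) : ℝ) = -piP p := by push_cast; ring
  rw [sinp, hfl, e, sinpSym, if_neg (by linarith), neg_neg, sinpBase, if_neg (by linarith),
    sub_self, sinpHalf_zero hp, neg_zero]

theorem sinp_of_ge' (hp : 1 < p) {t : ℝ} (ht : t ∈ Icc (piP p / 2) (piP p)) :
    sinp p t = sinpHalf p (piP p - t) := by
  rcases ht.2.eq_or_lt with h | h
  · rw [h, sinp_pi hp, sub_self, sinpHalf_zero hp]
  · exact sinp_of_ge hp ⟨ht.1, h⟩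

theorem continuousOn_sinp (hp : 1 < p) : ContinuousOn (sinp p) (Icc 0 (piP p)) := by
  have hpi := piP_pos hp
  rw [← Icc_union_Icc_eq_Icc (b := piP p / 2) (by linarith) (by linarith)]
  refine ContinuousOn.union_of_isClosed ?_ ?_ isClosed_Icc isClosed_Icc
  · exact (continuousOn_sinpHalf hp).congr fun t ht => sinp_of_le hp ht
  · refine ContinuousOn.congr (f := fun t => sinpHalf p (piP p - t)) ?_
      fun t ht => sinp_of_ge' hp ht
    refine (continuousOn_sinpHalf hp).comp (by fun_prop) fun t ht => ?_
    constructor <;> linarith [ht.1, ht.2]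

theorem sinp_pos (hp : 1 < p) {t : ℝ} (ht : t ∈ Ioo 0 (piP p)) : 0 < sinp p t := by
  have hpi := piP_pos hp
  rcases lt_trichotomy t (piP p / 2) with h | h | h
  · rw [sinp_of_le hp ⟨ht.1.le, h.le⟩]
    exact (sinpHalf_mem_Ioo hp ⟨ht.1, h⟩).1
  · rw [h, sinp_of_le hp ⟨by linarith, le_rfl⟩, sinpHalf_pi_div_two hp]
    exact one_pos
  · rw [sinp_of_ge hp ⟨h.le, ht.2⟩]
    exact (sinpHalf_mem_Ioo hp ⟨by linarith [ht.2], by linarith⟩).1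

theorem sinp_le_one (hp : 1 < p) {t : ℝ} (ht : t ∈ Icc 0 (piP p)) : sinp p t ≤ 1 := by
  rcases le_total t (piP p / 2) with h | h
  · rw [sinp_of_le hp ⟨ht.1, h⟩]
    exact (sinpHalf_spec hp ⟨ht.1, h⟩).1.2
  · rw [sinp_of_ge' hp ⟨h, ht.2⟩]
    exact (sinpHalf_spec hp ⟨by linarith [ht.2], by linarith⟩).1.2

theorem sinp_pi_sub (hp : 1 < p) {t : ℝ} (ht : t ∈ Icc 0 (piP p)) :
    sinp p (piP p - t) = sinp p t := by
  rcases le_total t (piP p / 2) with h | h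
  · rw [sinp_of_le hp ⟨ht.1, h⟩, sinp_of_ge' hp ⟨by linarith, by linarith [ht.1]⟩, sub_sub_self]
  · rw [sinp_of_ge' hp ⟨h, ht.2⟩, sinp_of_le hp ⟨by linarith [ht.2], by linarith⟩]

end SinP

/-- The derivative of `sin_p` on `(0, π_p)`. -/
noncomputable def sinpDeriv (p t : ℝ) : ℝ :=
  if t ≤ piP p / 2 then (1 - sinp p t ^ p) ^ (1 / p) else -(1 - sinp p t ^ p) ^ (1 / p)

/-- The function `|c|^{p-2} c`, where `c` is the derivative of `sin_p` on `(0, π_p)`. -/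
noncomputable def sinpFlux (p t : ℝ) : ℝ :=
  if t ≤ piP p / 2 then (1 - sinp p t ^ p) ^ ((p - 1) / p)
  else -(1 - sinp p t ^ p) ^ ((p - 1) / p)

section SinPDeriv

variable {p : ℝ}

theorem one_sub_sinp_rpow_nonneg (hp : 1 < p) {t : ℝ} (ht : t ∈ Ioo 0 (piP p)) :
    0 ≤ 1 - sinp p t ^ p := by
  have := Real.rpow_le_one (sinp_pos hp ht).le (sinp_le_one hp ⟨ht.1.le, ht.2.le⟩)
    (by linarith : 0 ≤ p)
  linarith

theorem continuousOn_signed_rpow (hp : 1 < p) {r : ℝ} (hr : 0 < r) :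
    ContinuousOn (fun t => if t ≤ piP p / 2 then (1 - sinp p t ^ p) ^ r
      else -(1 - sinp p t ^ p) ^ r) (Ioo 0 (piP p)) := by
  have hpi := piP_pos hp
  have hc : ContinuousOn (fun t => (1 - sinp p t ^ p) ^ r) (Ioo 0 (piP p)) := by
    have h0 := (continuousOn_sinp hp).mono Ioo_subset_Icc_self
    refine ContinuousOn.rpow_const (continuousOn_const.sub (h0.rpow_const fun t _ => Or.inr ?_))
      fun t _ => Or.inr hr.le
    linarith
  refine ContinuousOn.if ?_ (hc.mono inter_subset_left) (hc.neg.mono inter_subset_left)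
  rintro t ⟨-, ht⟩
  have : t = piP p / 2 := by
    have := frontier_le_subset_eq continuous_id continuous_const ht
    exact this
  have h1 : sinp p t = 1 := by
    rw [this, sinp_of_le hp ⟨by linarith, le_rfl⟩, sinpHalf_pi_div_two hp]
  simp [h1, Real.zero_rpow hr.ne']

theorem continuousOn_sinpDeriv (hp : 1 < p) : ContinuousOn (sinpDeriv p) (Ioo 0 (piP p)) :=
  continuousOn_signed_rpow hp (by positivity)

theorem continuousOn_sinpFlux (hp : 1 < p) : ContinuousOn (sinpFlux p) (Ioo 0 (piP p)) :=
  continuousOn_signed_rpow hp (div_pos (by linarith) (by linarith))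

theorem abs_sinpDeriv (hp : 1 < p) {t : ℝ} (ht : t ∈ Ioo 0 (piP p)) :
    |sinpDeriv p t| = (1 - sinp p t ^ p) ^ (1 / p) := by
  have := Real.rpow_nonneg (one_sub_sinp_rpow_nonneg hp ht) (1 / p)
  unfold sinpDeriv
  split_ifs
  · exact abs_of_nonneg this
  · rw [abs_neg, abs_of_nonneg this]

theorem abs_sinpDeriv_le_one (hp : 1 < p) {t : ℝ} (ht : t ∈ Ioo 0 (piP p)) :
    |sinpDeriv p t| ≤ 1 := by
  rw [abs_sinpDeriv hp ht]
  refine Real.rpow_le_one (one_sub_sinp_rpow_nonneg hp ht) ?_ (by positivity)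
  have := Real.rpow_nonneg (sinp_pos hp ht).le p
  linarith

theorem sinpFlux_eq (hp : 1 < p) {t : ℝ} (ht : t ∈ Ioo 0 (piP p)) :
    sinpFlux p t = |sinpDeriv p t| ^ (p - 2) * sinpDeriv p t := by
  have h0 := one_sub_sinp_rpow_nonneg hp ht
  have key : (1 - sinp p t ^ p) ^ ((p - 1) / p) =
      ((1 - sinp p t ^ p) ^ (1 / p)) ^ (p - 2) * (1 - sinp p t ^ p) ^ (1 / p) := by
    rcases h0.eq_or_lt with h | h
    · rw [← h, Real.zero_rpow (div_pos (by linarith) (by linarith)).ne',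
        Real.zero_rpow (by positivity : 1 / p ≠ 0), mul_zero]
    · rw [← Real.rpow_mul h.le, ← Real.rpow_add h]
      congr 1
      field_simp
      ring
  rw [abs_sinpDeriv hp ht]
  unfold sinpFlux sinpDeriv
  split_ifs
  · exact key
  · rw [key]; ring

theorem hasDerivAt_sinp_of_lt (hp : 1 < p) {t : ℝ} (ht : t ∈ Ioo 0 (piP p / 2)) :
    HasDerivAt (sinp p) ((1 - sinp p t ^ p) ^ (1 / p)) t := by
  rw [sinp_of_le hp ⟨ht.1.le, ht.2.le⟩]
  refine (hasDerivAt_sinpHalf hp ht).congr_of_eventuallyEq ?_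
  filter_upwards [Icc_mem_nhds ht.1 ht.2] with z hz using sinp_of_le hp hz

theorem hasDerivAt_sinp (hp : 1 < p) {t : ℝ} (ht : t ∈ Ioo 0 (piP p)) :
    HasDerivAt (sinp p) (sinpDeriv p t) t := by
  have hpi := piP_pos hp
  have hne : ∀ s ∈ Ioo 0 (piP p), s ≠ piP p / 2 → HasDerivAt (sinp p) (sinpDeriv p s) s := by
    intro s hs hs'
    rcases lt_or_gt_of_ne hs' with h | h
    · rw [sinpDeriv, if_pos h.le]
      exact hasDerivAt_sinp_of_lt hp ⟨hs.1, h⟩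
    · rw [sinpDeriv, if_neg (not_le.2 h), ← sinp_pi_sub hp ⟨hs.1.le, hs.2.le⟩]
      have h1 := hasDerivAt_sinp_of_lt hp (t := piP p - s) ⟨by linarith [hs.2], by linarith⟩
      have h2 := h1.comp_const_sub (piP p) s
      refine h2.congr_of_eventuallyEq ?_
      filter_upwards [Icc_mem_nhds hs.1 hs.2] with z hz using (sinp_pi_sub hp hz).symm
  rcases eq_or_ne t (piP p / 2) with h | h
  · refine hasDerivAt_of_eventually_hasDerivAt_of_tendsto ?_
      ((continuousOn_sinp hp).continuousAt (Icc_mem_nhds ht.1 ht.2))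
      ((continuousOn_sinpDeriv hp).continuousAt (Ioo_mem_nhds ht.1 ht.2))
    filter_upwards [mem_nhdsWithin_of_mem_nhds (Ioo_mem_nhds ht.1 ht.2),
      self_mem_nhdsWithin] with s hs hs'
    exact hne s hs (by rw [← h]; exact hs')
  · exact hne t ht h

theorem sinpFlux_pi_sub (hp : 1 < p) {t : ℝ} (ht : t ∈ Ioo 0 (piP p)) (h : t ≠ piP p / 2) :
    sinpFlux p (piP p - t) = -sinpFlux p t := by
  have e := sinp_pi_sub hp ⟨ht.1.le, ht.2.le⟩
  rcases lt_or_gt_of_ne h with h | h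
  · rw [sinpFlux, sinpFlux, e, if_neg (by linarith), if_pos h.le]
  · rw [sinpFlux, sinpFlux, e, if_pos (by linarith), if_neg (by linarith), neg_neg]

theorem hasDerivAt_sinpFlux_of_lt (hp : 1 < p) {t : ℝ} (ht : t ∈ Ioo 0 (piP p / 2)) :
    HasDerivAt (sinpFlux p) (-((p - 1) * sinp p t ^ (p - 1))) t := by
  have hpi := piP_pos hp
  have hd := hasDerivAt_sinp_of_lt hp ht
  have hs : sinp p t ∈ Ioo (0 : ℝ) 1 := by
    rw [sinp_of_le hp ⟨ht.1.le, ht.2.le⟩]; exact sinpHalf_mem_Ioo hp ht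
  have hq := one_sub_rpow_pos hp ⟨hs.1.le, hs.2⟩
  have h1 := ((hd.rpow_const (p := p) (Or.inl hs.1.ne')).const_sub 1).rpow_const
    (p := (p - 1) / p) (Or.inl hq.ne')
  refine (h1.congr_deriv ?_).congr_of_eventuallyEq ?_
  · have e : (p - 1) / p - 1 = -(1 / p) := by field_simp; ring
    rw [e, Real.rpow_neg hq.le]
    have := (Real.rpow_pos_of_pos hq (1 / p)).ne'
    field_simp
  · filter_upwards [Iio_mem_nhds ht.2] with s hs'
    rw [sinpFlux, if_pos (le_of_lt hs')]

theorem hasDerivAt_sinpFlux (hp : 1 < p) {t : ℝ} (ht : t ∈ Ioo 0 (piP p)) :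
    HasDerivAt (sinpFlux p) (-((p - 1) * sinp p t ^ (p - 1))) t := by
  have hpi := piP_pos hp
  have hne : ∀ s ∈ Ioo 0 (piP p), s ≠ piP p / 2 →
      HasDerivAt (sinpFlux p) (-((p - 1) * sinp p s ^ (p - 1))) s := by
    intro s hs hs'
    rcases lt_or_gt_of_ne hs' with h | h
    · exact hasDerivAt_sinpFlux_of_lt hp ⟨hs.1, h⟩
    · rw [← sinp_pi_sub hp ⟨hs.1.le, hs.2.le⟩]
      have h1 := hasDerivAt_sinpFlux_of_lt hp (t := piP p - s) ⟨by linarith [hs.2], by linarith⟩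
      have h2 := (h1.comp_const_sub (piP p) s).neg
      rw [neg_neg] at h2
      refine h2.congr_of_eventuallyEq ?_
      filter_upwards [Ioo_mem_nhds hs.1 hs.2, Ioi_mem_nhds h] with z hz hz'
      simp [sinpFlux_pi_sub hp hz (ne_of_gt hz')]
  rcases eq_or_ne t (piP p / 2) with h | h
  · refine hasDerivAt_of_eventually_hasDerivAt_of_tendsto
      (g := fun t => -((p - 1) * sinp p t ^ (p - 1))) ?_
      ((continuousOn_sinpFlux hp).continuousAt (Ioo_mem_nhds ht.1 ht.2)) ?_
    · filter_upwards [mem_nhdsWithin_of_mem_nhds (Ioo_mem_nhds ht.1 ht.2),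
        self_mem_nhdsWithin] with s hs hs'
      exact hne s hs (by rw [← h]; exact hs')
    · have := (continuousOn_sinp hp).continuousAt (Icc_mem_nhds ht.1 ht.2)
      exact (continuousAt_const.mul (this.rpow_const (Or.inr (by linarith)))).neg
  · exact hne t ht h

end SinPDeriv

/-- `s` is a positive solution on `(a, b)` of `-(|s'|^{p-2} s')' = μ s^{p-1}` with zero boundary
values, and `c` is its derivative. -/
structure IsDirichletProfile (p μ a b : ℝ) (s c : ℝ → ℝ) : Prop where
  pos : ∀ t ∈ Ioo a b, 0 < s t
  le_one : ∀ t ∈ Ioo a b, s t ≤ 1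
  left : s a = 0
  right : s b = 0
  cont : ContinuousOn s (Icc a b)
  cont_deriv : ContinuousOn c (Ioo a b)
  bdd_deriv : ∃ M, ∀ t ∈ Ioo a b, |c t| ≤ M
  hasDeriv : ∀ t ∈ Ioo a b, HasDerivAt s (c t) t
  hasDeriv_flux : ∀ t ∈ Ioo a b,
    HasDerivAt (fun t => |c t| ^ (p - 2) * c t) (-(μ * s t ^ (p - 1))) t

theorem isDirichletProfile_sinp {p : ℝ} (hp : 1 < p) {a b : ℝ} (hab : a < b) :
    IsDirichletProfile p (piP p ^ p * (p - 1) * (b - a) ^ (-p)) a b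
      (fun t => sinp p (piP p * (t - a) / (b - a)))
      (fun t => piP p / (b - a) * sinpDeriv p (piP p * (t - a) / (b - a))) := by
  have hpi := piP_pos hp
  have hba : 0 < b - a := sub_pos.2 hab
  have hκ : 0 < piP p / (b - a) := div_pos hpi hba
  have hg : ∀ t, HasDerivAt (fun t => piP p * (t - a) / (b - a)) (piP p / (b - a)) t := fun t => by
    simpa using (((hasDerivAt_id t).sub_const a).const_mul (piP p)).div_const (b - a)
  have hgc : Continuous (fun t => piP p * (t - a) / (b - a)) := by fun_prop
  have hm : ∀ t ∈ Ioo a b, piP p * (t - a) / (b - a) ∈ Ioo 0 (piP p) := fun t ht => by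
    refine ⟨div_pos (mul_pos hpi (sub_pos.2 ht.1)) hba, ?_⟩
    rw [div_lt_iff₀ hba]
    exact mul_lt_mul_of_pos_left (by linarith [ht.2]) hpi
  have hm' : ∀ t ∈ Icc a b, piP p * (t - a) / (b - a) ∈ Icc 0 (piP p) := fun t ht => by
    refine ⟨div_nonneg (mul_nonneg hpi.le (sub_nonneg.2 ht.1)) hba.le, ?_⟩
    rw [div_le_iff₀ hba]
    exact mul_le_mul_of_nonneg_left (by linarith [ht.2]) hpi.le
  refine
    { pos := fun t ht => sinp_pos hp (hm t ht)
      le_one := fun t ht => sinp_le_one hp (Ioo_subset_Icc_self (hm t ht))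
      left := by simp [sinp_zero hp]
      right := by simp [mul_div_assoc, div_self hba.ne', sinp_pi hp]
      cont := (continuousOn_sinp hp).comp hgc.continuousOn hm'
      cont_deriv := continuousOn_const.mul
        ((continuousOn_sinpDeriv hp).comp hgc.continuousOn hm)
      bdd_deriv := ⟨piP p / (b - a), fun t ht => ?_⟩
      hasDeriv := fun t ht => ?_
      hasDeriv_flux := fun t ht => ?_ }
  · rw [abs_mul, abs_of_pos hκ]
    exact mul_le_of_le_one_right hκ.le (abs_sinpDeriv_le_one hp (hm t ht))
  · rw [mul_comm]
    exact HasDerivAt.comp (h₂ := sinp p) t (hasDerivAt_sinp hp (hm t ht)) (hg t)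
  · have h1 := ((hasDerivAt_sinpFlux hp (hm t ht)).comp t (hg t)).const_mul
      ((piP p / (b - a)) ^ (p - 1))
    refine (h1.congr_deriv ?_).congr_of_eventuallyEq ?_
    · have : (piP p / (b - a)) ^ (p - 1) * (piP p / (b - a)) = piP p ^ p * (b - a) ^ (-p) := by
        rw [Real.rpow_sub_one hκ.ne', div_mul_cancel₀ _ hκ.ne', Real.div_rpow hpi.le hba.le,
          Real.rpow_neg hba.le, div_eq_mul_inv]
      linear_combination (-(p - 1) * sinp p (piP p * (t - a) / (b - a)) ^ (p - 1)) * this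
    · filter_upwards [Ioo_mem_nhds ht.1 ht.2] with z hz
      rw [Function.comp_apply, sinpFlux_eq hp (hm z hz), abs_mul, abs_of_pos hκ,
        Real.mul_rpow hκ.le (abs_nonneg _), show p - 1 = p - 2 + 1 by ring,
        Real.rpow_add_one hκ.ne']
      ring

theorem stripDomain_zero_eq {n : ℕ} (a b : Fin n → ℝ) :
    stripDomain n 0 a b = Set.pi univ fun i => Ioo (a i) (b i) := by
  ext x; simp [stripDomain, Set.mem_pi]

theorem mem_stripDomain_zero {n : ℕ} {a b x : Fin n → ℝ} :
    x ∈ stripDomain n 0 a b ↔ ∀ i, x i ∈ Ioo (a i) (b i) := by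
  simp [stripDomain]

theorem isOpen_stripDomain_zero {n : ℕ} (a b : Fin n → ℝ) : IsOpen (stripDomain n 0 a b) := by
  rw [stripDomain_zero_eq]
  exact isOpen_set_pi finite_univ fun i _ => isOpen_Ioo

theorem stripDomain_zero_subset_Icc {n : ℕ} (a b : Fin n → ℝ) :
    stripDomain n 0 a b ⊆ Icc a b := fun x hx => by
  rw [mem_stripDomain_zero] at hx
  exact ⟨fun i => (hx i).1.le, fun i => (hx i).2.le⟩

theorem hasFDerivAt_prod_apply {n : ℕ} {f : Fin n → ℝ → ℝ} {d x : Fin n → ℝ}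
    (h : ∀ j, HasDerivAt (f j) (d j) (x j)) :
    HasFDerivAt (fun x : Fin n → ℝ => ∏ j, f j (x j))
      (∑ i, (∏ j ∈ Finset.univ.erase i, f j (x j)) •
        (d i • ContinuousLinearMap.proj (R := ℝ) (φ := fun _ : Fin n => ℝ) i)) x := by
  refine HasFDerivAt.finsetProd (g := fun j (x : Fin n → ℝ) => f j (x j))
    fun i _ => ?_
  exact (h i).comp_hasFDerivAt x
    (ContinuousLinearMap.proj (R := ℝ) (φ := fun _ : Fin n => ℝ) i).hasFDerivAt

theorem pder_prod_apply {n : ℕ} {f : Fin n → ℝ → ℝ} {d x : Fin n → ℝ}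
    (h : ∀ j, HasDerivAt (f j) (d j) (x j)) (i : Fin n) :
    pder i (fun x : Fin n → ℝ => ∏ j, f j (x j)) x =
      (∏ j ∈ Finset.univ.erase i, f j (x j)) * d i := by
  rw [pder, (hasFDerivAt_prod_apply h).fderiv]
  simp [Pi.single_apply]

theorem tsupport_pder_subset {n : ℕ} (i : Fin n) (u : (Fin n → ℝ) → ℝ) :
    tsupport (pder i u) ⊆ tsupport u :=
  tsupport_fderiv_apply_subset ℝ _

theorem continuous_pder {n : ℕ} (i : Fin n) {u : (Fin n → ℝ) → ℝ} (hu : ContDiff ℝ 1 u) :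
    Continuous (pder i u) :=
  (hu.continuous_fderiv one_ne_zero).clm_apply continuous_const

theorem integrable_mul_of_tsupport_subset {n : ℕ} {D : Set (Fin n → ℝ)}
    {F ψ : (Fin n → ℝ) → ℝ} (hF : ContinuousOn F D) (hψ : Continuous ψ)
    (hψc : HasCompactSupport ψ) (hψD : tsupport ψ ⊆ D) : Integrable fun x => F x * ψ x := by
  refine IntegrableOn.integrable_of_forall_notMem_eq_zero (s := tsupport ψ)
    (((hF.mono hψD).mul hψ.continuousOn).integrableOn_compact hψc) fun x hx => ?_
  rw [image_eq_zero_of_notMem_tsupport hx, mul_zero]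

theorem HasCompactSupport.pder {n : ℕ} {u : (Fin n → ℝ) → ℝ} (hu : HasCompactSupport u)
    (i : Fin n) : HasCompactSupport (pder i u) :=
  hu.of_isClosed_subset (isClosed_tsupport _) (tsupport_pder_subset i u)

theorem integral_mul_pder {n : ℕ} {D : Set (Fin n → ℝ)} {F φ : (Fin n → ℝ) → ℝ} (i : Fin n)
    (hF : ∀ x ∈ D, DifferentiableAt ℝ F x) (hF' : ContinuousOn (pder i F) D)
    (hφ : ContDiff ℝ 1 φ) (hφc : HasCompactSupport φ) (hφD : tsupport φ ⊆ D) :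
    ∫ x, F x * pder i φ x = -∫ x, pder i F x * φ x := by
  have hFc : ContinuousOn F D := fun x hx => (hF x hx).continuousAt.continuousWithinAt
  refine integral_mul_fderiv_eq_neg_fderiv_mul_of_integrable
    (integrable_mul_of_tsupport_subset hF' hφ.continuous hφc hφD)
    (integrable_mul_of_tsupport_subset hFc (continuous_pder i hφ) (hφc.pder i)
      ((tsupport_pder_subset i φ).trans hφD))
    (integrable_mul_of_tsupport_subset hFc hφ.continuous hφc hφD)
    (fun x hx => hF x (hφD hx)) fun x _ => hφ.differentiable one_ne_zero x

section Rectangle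

variable {n : ℕ} {p : ℝ} {μ a b : Fin n → ℝ} {s c : Fin n → ℝ → ℝ}

theorem prod_profile_pos (hs : ∀ i, IsDirichletProfile p (μ i) (a i) (b i) (s i) (c i))
    {x : Fin n → ℝ} (hx : x ∈ stripDomain n 0 a b) : 0 < ∏ i, s i (x i) :=
  Finset.prod_pos fun i _ => (hs i).pos _ (mem_stripDomain_zero.1 hx i)

theorem pder_prod_profile (hs : ∀ i, IsDirichletProfile p (μ i) (a i) (b i) (s i) (c i))
    (i : Fin n) {x : Fin n → ℝ} (hx : x ∈ stripDomain n 0 a b) :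
    pder i (fun x : Fin n → ℝ => ∏ j, s j (x j)) x =
      (∏ j ∈ Finset.univ.erase i, s j (x j)) * c i (x i) :=
  pder_prod_apply (fun j => (hs j).hasDeriv _ (mem_stripDomain_zero.1 hx j)) i

theorem continuousOn_apply_of_continuousOn_Ioo {f : ℝ → ℝ} (i : Fin n)
    (hf : ContinuousOn f (Ioo (a i) (b i))) :
    ContinuousOn (fun x : Fin n → ℝ => f (x i)) (stripDomain n 0 a b) :=
  hf.comp (continuous_apply i).continuousOn fun _ hx => mem_stripDomain_zero.1 hx i

theorem continuousOn_prod_profile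
    (hs : ∀ i, IsDirichletProfile p (μ i) (a i) (b i) (s i) (c i)) (t : Finset (Fin n)) :
    ContinuousOn (fun x : Fin n → ℝ => ∏ j ∈ t, s j (x j)) (stripDomain n 0 a b) :=
  continuousOn_finsetProd _ fun j _ =>
    continuousOn_apply_of_continuousOn_Ioo j ((hs j).cont.mono Ioo_subset_Icc_self)

theorem continuousOn_pder_prod_profile
    (hs : ∀ i, IsDirichletProfile p (μ i) (a i) (b i) (s i) (c i)) (i : Fin n) :
    ContinuousOn (pder i (fun x : Fin n → ℝ => ∏ j, s j (x j))) (stripDomain n 0 a b) :=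
  ((continuousOn_prod_profile hs _).mul
    (continuousOn_apply_of_continuousOn_Ioo i (hs i).cont_deriv)).congr
      fun _ hx => pder_prod_profile hs i hx

/-- The weak form of the eigenvalue equation, one direction at a time. -/
theorem integral_flux_mul_pder
    (hs : ∀ i, IsDirichletProfile p (μ i) (a i) (b i) (s i) (c i)) (i : Fin n)
    {φ : (Fin n → ℝ) → ℝ} (hφ : ContDiff ℝ 1 φ) (hφc : HasCompactSupport φ)
    (hφD : tsupport φ ⊆ stripDomain n 0 a b) :
    ∫ x in stripDomain n 0 a b,
        |pder i (fun x : Fin n → ℝ => ∏ j, s j (x j)) x| ^ (p - 2) *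
          pder i (fun x : Fin n → ℝ => ∏ j, s j (x j)) x * pder i φ x =
      μ i * ∫ x in stripDomain n 0 a b, (∏ j, s j (x j)) ^ (p - 1) * φ x := by
  set D := stripDomain n 0 a b with hD
  have hmem : ∀ {x}, x ∈ D → ∀ j, x j ∈ Ioo (a j) (b j) := fun hx => mem_stripDomain_zero.1 hx
  set f : Fin n → ℝ → ℝ := fun j t =>
    if j = i then |c j t| ^ (p - 2) * c j t else s j t ^ (p - 1) with hf
  set d : Fin n → ℝ → ℝ := fun j t =>
    if j = i then -(μ j * s j t ^ (p - 1)) else c j t * (p - 1) * s j t ^ (p - 1 - 1) with hd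
  have hfd : ∀ x ∈ D, ∀ j, HasDerivAt (f j) (d j (x j)) (x j) := by
    intro x hx j
    by_cases hj : j = i
    · simp only [hf, hd, hj, if_true]
      exact (hs i).hasDeriv_flux _ (hmem hx i)
    · simp only [hf, hd, hj, if_false]
      exact ((hs j).hasDeriv _ (hmem hx j)).rpow_const (Or.inl ((hs j).pos _ (hmem hx j)).ne')
  have herase : ∀ x ∈ D, ∏ j ∈ Finset.univ.erase i, f j (x j) =
      (∏ j ∈ Finset.univ.erase i, s j (x j)) ^ (p - 1) := by
    intro x hx
    rw [← Real.finsetProd_rpow _ _ fun j _ => ((hs j).pos _ (hmem hx j)).le]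
    refine Finset.prod_congr rfl fun j hj => ?_
    simp [hf, Finset.ne_of_mem_erase hj]
  have hG' : ∀ x ∈ D, pder i (fun x : Fin n → ℝ => ∏ j, f j (x j)) x =
      -(μ i * (∏ j, s j (x j)) ^ (p - 1)) := by
    intro x hx
    rw [pder_prod_apply (hfd x hx) i, herase x hx,
      ← Finset.prod_erase_mul _ (fun j => s j (x j)) (Finset.mem_univ i),
      Real.mul_rpow (Finset.prod_nonneg fun j _ => ((hs j).pos _ (hmem hx j)).le)
        ((hs i).pos _ (hmem hx i)).le]
    simp only [hd, if_true]
    ring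
  have hG : ∀ x ∈ D, |pder i (fun x : Fin n → ℝ => ∏ j, s j (x j)) x| ^ (p - 2) *
      pder i (fun x : Fin n → ℝ => ∏ j, s j (x j)) x = ∏ j, f j (x j) := by
    intro x hx
    have hP : 0 < ∏ j ∈ Finset.univ.erase i, s j (x j) :=
      Finset.prod_pos fun j _ => (hs j).pos _ (hmem hx j)
    rw [← Finset.prod_erase_mul _ (fun j => f j (x j)) (Finset.mem_univ i), herase x hx,
      pder_prod_profile hs i hx, abs_mul, abs_of_pos hP, Real.mul_rpow hP.le (abs_nonneg _),
      show p - 1 = p - 2 + 1 by ring, Real.rpow_add_one hP.ne']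
    simp only [hf, if_true]
    ring
  have hcont : ContinuousOn (pder i (fun x : Fin n → ℝ => ∏ j, f j (x j))) D := by
    refine ContinuousOn.congr (continuousOn_const.mul
      ((continuousOn_prod_profile hs Finset.univ).rpow_const fun x hx =>
        Or.inl (prod_profile_pos hs hx).ne')).neg hG'
  have key := integral_mul_pder i (fun x hx => (hasFDerivAt_prod_apply (hfd x hx)).differentiableAt)
    hcont hφ hφc hφD
  have hoff : ∀ x, x ∉ D → φ x = 0 := fun x hx =>
    image_eq_zero_of_notMem_tsupport fun h => hx (hφD h)
  have hoff' : ∀ x, x ∉ D → pder i φ x = 0 := fun x hx =>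
    image_eq_zero_of_notMem_tsupport fun h => hx (hφD (tsupport_pder_subset i φ h))
  rw [← setIntegral_eq_integral_of_forall_compl_eq_zero (s := D)
      (f := fun x => (∏ j, f j (x j)) * pder i φ x)
      (fun x hx => by rw [hoff' x hx, mul_zero]),
    ← setIntegral_eq_integral_of_forall_compl_eq_zero (s := D)
      (f := fun x => pder i (fun x : Fin n → ℝ => ∏ j, f j (x j)) x * φ x)
      (fun x hx => by rw [hoff x hx, mul_zero])] at key
  have hDm : MeasurableSet D := (isOpen_stripDomain_zero a b).measurableSet
  rw [setIntegral_congr_fun hDm (fun x hx => by rw [hG x hx] :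
    EqOn _ (fun x => (∏ j, f j (x j)) * pder i φ x) D), key, ← integral_const_mul,
    ← integral_neg]
  refine setIntegral_congr_fun hDm fun x hx => ?_
  rw [hG' x hx]
  ring

theorem mul_rpow_sub_one_mul_le (hp : 1 < p) {A B : ℝ} (hA : 0 ≤ A) (hB : 0 ≤ B) :
    p * (A ^ (p - 1) * B) ≤ B ^ p + (p - 1) * A ^ p := by
  have hc : p.HolderConjugate (p / (p - 1)) := Real.HolderConjugate.conjExponent hp
  have h := Real.young_inequality_of_nonneg hB (Real.rpow_nonneg hA (p - 1)) hc
  rw [← Real.rpow_mul hA, mul_div_cancel₀ _ (by linarith : p - 1 ≠ 0)] at h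
  have hp0 : p ≠ 0 := by linarith
  calc p * (A ^ (p - 1) * B) = p * (B * A ^ (p - 1)) := by ring
    _ ≤ p * (B ^ p / p + A ^ p / (p / (p - 1))) :=
        mul_le_mul_of_nonneg_left h (by linarith)
    _ = B ^ p + (p - 1) * A ^ p := by field_simp

/-- The one-directional Poincaré inequality, from Picone's inequality. -/
theorem mul_integral_abs_rpow_le (hp : 1 < p)
    (hs : ∀ i, IsDirichletProfile p (μ i) (a i) (b i) (s i) (c i)) (i : Fin n)
    {φ : (Fin n → ℝ) → ℝ} (hφ : ContDiff ℝ 1 φ) (hφc : HasCompactSupport φ)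
    (hφD : tsupport φ ⊆ stripDomain n 0 a b) :
    μ i * ∫ x, |φ x| ^ p ≤ ∫ x, |pder i φ x| ^ p := by
  set D := stripDomain n 0 a b with hD
  have hmem : ∀ {x}, x ∈ D → x i ∈ Ioo (a i) (b i) := fun hx => mem_stripDomain_zero.1 hx i
  have hp0 : p ≠ 0 := by linarith
  set W : ℝ → ℝ := fun t => |c i t| ^ (p - 2) * c i t / s i t ^ (p - 1) with hW
  set r : ℝ → ℝ := fun t => |c i t| / s i t with hr
  have hr0 : ∀ {t}, t ∈ Ioo (a i) (b i) → 0 ≤ r t := fun ht =>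
    div_nonneg (abs_nonneg _) ((hs i).pos _ ht).le
  have hWd : ∀ t ∈ Ioo (a i) (b i), HasDerivAt W (-(μ i) - (p - 1) * r t ^ p) t := by
    intro t ht
    have hpos := (hs i).pos _ ht
    have h1 := ((hs i).hasDeriv _ ht).rpow_const (p := p - 1) (Or.inl hpos.ne')
    refine (((hs i).hasDeriv_flux _ ht).div h1 (Real.rpow_pos_of_pos hpos _).ne').congr_deriv ?_
    have hne := (Real.rpow_pos_of_pos hpos (p - 1)).ne'
    have e1 : s i t ^ (p - 1 - 1) = s i t ^ (p - 1) / s i t := Real.rpow_sub_one hpos.ne' _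
    have e2 : s i t ^ p = s i t ^ (p - 1) * s i t := by
      rw [Real.rpow_sub_one hpos.ne', div_mul_cancel₀ _ hpos.ne']
    have e3 : |c i t| ^ (p - 2) * c i t * c i t = |c i t| ^ p := by
      rcases eq_or_ne (c i t) 0 with h | h
      · simp [h, Real.zero_rpow hp0]
      · rw [mul_assoc, ← abs_mul_abs_self, ← mul_assoc, ← Real.rpow_add_one (abs_pos.2 h).ne',
          ← Real.rpow_add_one (abs_pos.2 h).ne']
        congr 1
        ring
    rw [hr, Real.div_rpow (abs_nonneg _) hpos.le, ← e3, e2, e1]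
    field_simp
  have hWc : ContinuousOn (fun x : Fin n → ℝ => W (x i)) D :=
    continuousOn_apply_of_continuousOn_Ioo i fun t ht =>
      (hWd t ht).continuousAt.continuousWithinAt
  have hrc : ContinuousOn (fun x : Fin n → ℝ => r (x i) ^ p) D := by
    refine continuousOn_apply_of_continuousOn_Ioo i (f := fun t => r t ^ p) ?_
    exact ((hs i).cont_deriv.abs.div ((hs i).cont.mono Ioo_subset_Icc_self)
      fun t ht => ((hs i).pos _ ht).ne').rpow_const fun _ _ => Or.inr (by linarith)
  have hFd : ∀ x ∈ D, HasFDerivAt (fun x : Fin n → ℝ => W (x i))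
      ((-(μ i) - (p - 1) * r (x i) ^ p) •
        ContinuousLinearMap.proj (R := ℝ) (φ := fun _ : Fin n => ℝ) i) x := fun x hx =>
    HasDerivAt.comp_hasFDerivAt (h₂ := W) (f := fun x : Fin n → ℝ => x i) x (hWd _ (hmem hx))
      (ContinuousLinearMap.proj (R := ℝ) (φ := fun _ : Fin n => ℝ) i).hasFDerivAt
  have hF' : ∀ x ∈ D, pder i (fun x : Fin n → ℝ => W (x i)) x =
      -(μ i) - (p - 1) * r (x i) ^ p := fun x hx => by
    rw [pder, (hFd x hx).fderiv]; simp
  set ψ : (Fin n → ℝ) → ℝ := fun x => |φ x| ^ p with hψ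
  have hψ1 : ContDiff ℝ 1 ψ := by
    simpa [hψ, Real.norm_eq_abs] using hφ.norm_rpow hp
  have hψs : tsupport ψ ⊆ tsupport φ := closure_mono fun x hx => by
    contrapose! hx
    rw [Function.notMem_support] at hx ⊢
    simp [hψ, hx, Real.zero_rpow hp0]
  have hψc : HasCompactSupport ψ := hφc.of_isClosed_subset (isClosed_tsupport _) hψs
  have hψ' : ∀ x, pder i ψ x = p * |φ x| ^ (p - 2) * φ x * pder i φ x := by
    intro x
    have h : HasFDerivAt ψ ((p * |φ x| ^ (p - 2) * φ x) • fderiv ℝ φ x) x :=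
      HasDerivAt.comp_hasFDerivAt x (hasDerivAt_abs_rpow (φ x) hp)
        (hφ.differentiable one_ne_zero x).hasFDerivAt
    rw [pder, h.fderiv]
    simp [pder]
  have key := integral_mul_pder i (fun x hx => (hFd x hx).differentiableAt)
    ((continuousOn_const.sub (continuousOn_const.mul hrc)).congr hF') hψ1 hψc (hψs.trans hφD)
  have hoff : ∀ x, x ∉ D → φ x = 0 := fun x hx =>
    image_eq_zero_of_notMem_tsupport fun h => hx (hφD h)
  have hoff' : ∀ x, x ∉ D → pder i φ x = 0 := fun x hx =>
    image_eq_zero_of_notMem_tsupport fun h => hx (hφD (tsupport_pder_subset i φ h))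
  have i1 : Integrable fun x => |pder i φ x| ^ p := by
    refine Continuous.integrable_of_hasCompactSupport
      ((continuous_pder i hφ).abs.rpow_const fun _ => Or.inr (by linarith))
      ((hφc.pder i).comp_left (g := fun t => |t| ^ p) (by simp [Real.zero_rpow hp0]))
  have i2 : Integrable ψ := hψ1.continuous.integrable_of_hasCompactSupport hψc
  have i3 : Integrable fun x => r (x i) ^ p * ψ x :=
    integrable_mul_of_tsupport_subset hrc hψ1.continuous hψc (hψs.trans hφD)
  have i4 : Integrable fun x => W (x i) * pder i ψ x :=
    integrable_mul_of_tsupport_subset hWc (continuous_pder i hψ1) (hψc.pder i)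
      ((tsupport_pder_subset i ψ).trans (hψs.trans hφD))
  have e : ∫ x, pder i (fun x : Fin n → ℝ => W (x i)) x * ψ x =
      -(μ i * ∫ x, ψ x) - (p - 1) * ∫ x, r (x i) ^ p * ψ x := by
    rw [← integral_const_mul, ← integral_const_mul, ← integral_neg,
      ← integral_sub (f := fun x => -(μ i * ψ x)) (i2.const_mul _).neg (i3.const_mul _)]
    refine integral_congr_ae (Eventually.of_forall fun x => ?_)
    by_cases hx : x ∈ D
    · dsimp only; rw [hF' x hx]; ring
    · simp [hψ, hoff x hx, Real.zero_rpow hp0]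
  have hle : ∫ x, W (x i) * pder i ψ x ≤
      ∫ x, (|pder i φ x| ^ p + (p - 1) * (r (x i) ^ p * ψ x)) := by
    refine integral_mono i4 (i1.add (i3.const_mul _)) fun x => ?_
    by_cases hx : x ∈ D
    · have hpos := (hs i).pos _ (hmem hx)
      have hA : 0 ≤ r (x i) * |φ x| := mul_nonneg (hr0 (hmem hx)) (abs_nonneg _)
      have hy := mul_rpow_sub_one_mul_le hp hA (abs_nonneg (pder i φ x))
      rw [Real.mul_rpow (hr0 (hmem hx)) (abs_nonneg _),
        Real.mul_rpow (hr0 (hmem hx)) (abs_nonneg _)] at hy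
      have habs : ∀ y : ℝ, |y| ^ (p - 2) * |y| = |y| ^ (p - 1) := fun y => by
        rcases eq_or_ne y 0 with h | h
        · simp [h, Real.zero_rpow (by linarith : p - 1 ≠ 0)]
        · rw [← Real.rpow_add_one (abs_pos.2 h).ne']; congr 1; ring
      have hWabs : |W (x i)| = r (x i) ^ (p - 1) := by
        simp only [hW, hr]
        rw [abs_div, abs_mul, abs_of_nonneg (Real.rpow_nonneg (abs_nonneg _) _), habs,
          abs_of_pos (Real.rpow_pos_of_pos hpos _), Real.div_rpow (abs_nonneg _) hpos.le]
      refine le_trans (le_abs_self _) (le_trans (le_of_eq ?_) hy)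
      dsimp only
      rw [hψ', abs_mul, hWabs, abs_mul, abs_mul, abs_mul, abs_of_pos (by linarith : 0 < p),
        abs_of_nonneg (Real.rpow_nonneg (abs_nonneg _) _), ← habs (φ x)]
      ring
    · dsimp only
      rw [hψ']
      simp [hψ, hoff x hx, hoff' x hx, Real.zero_rpow hp0]
  rw [integral_add i1 (i3.const_mul _), integral_const_mul] at hle
  rw [key, e] at hle
  linarith

end Rectangle

theorem tendsto_eLpNorm_sub_of_dominated {α E : Type*} [MeasurableSpace α] {ν : Measure α}
    [NormedAddCommGroup E] {q : ℝ≥0∞} (hq : q ≠ ⊤) (hq0 : q ≠ 0) {F : ℕ → α → E} {G : α → E}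
    (hF : ∀ k, AEStronglyMeasurable (F k) ν) (hG : AEStronglyMeasurable G ν)
    {g : α → ℝ} (hg : MemLp g q ν) (hFg : ∀ k, ∀ᵐ x ∂ν, ‖F k x - G x‖ ≤ g x)
    (hlim : ∀ᵐ x ∂ν, Tendsto (fun k => F k x) atTop (𝓝 (G x))) :
    Tendsto (fun k => eLpNorm (F k - G) q ν) atTop (𝓝 0) := by
  have hr : 0 < q.toReal := toReal_pos hq0 hq
  simp_rw [eLpNorm_eq_lintegral_rpow_enorm_toReal hq0 hq]
  have h : Tendsto (fun k => ∫⁻ x, ‖(F k - G) x‖ₑ ^ q.toReal ∂ν) atTop (𝓝 (∫⁻ _, 0 ∂ν)) := by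
    refine tendsto_lintegral_of_dominated_convergence' (fun x => ‖g x‖ₑ ^ q.toReal)
      (fun k => ((hF k).sub hG).enorm.pow_const _) (fun k => ?_)
      (lintegral_rpow_enorm_lt_top_of_eLpNorm_lt_top hq0 hq hg.2).ne ?_
    · filter_upwards [hFg k] with x hx
      refine ENNReal.rpow_le_rpow ?_ hr.le
      rw [enorm_le_iff_norm_le]
      exact hx.trans (le_abs_self _)
    · filter_upwards [hlim] with x hx
      have h1 : Tendsto (fun k => ‖(F k - G) x‖ₑ) atTop (𝓝 0) := by
        have := (hx.sub_const (G x)).enorm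
        simpa using this
      have := (ENNReal.continuous_rpow_const (y := q.toReal)).tendsto 0 |>.comp h1
      simpa [Function.comp_def, ENNReal.zero_rpow_of_pos hr] using this
  rw [lintegral_zero] at h
  have := (ENNReal.continuous_rpow_const (y := 1 / q.toReal)).tendsto 0 |>.comp h
  simpa [Function.comp_def, ENNReal.zero_rpow_of_pos (inv_pos.2 hr)] using this

section Jets

variable {n : ℕ} {q : ℝ≥0∞} [Fact (1 ≤ q)] {D : Set (Fin n → ℝ)}

/-- The function `w = (u, g₁, …, gₙ)` represents an element `u` of `W₀^{1,q}(D)` together with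
its weak gradient `g`. -/
def RepresentsW0 (q : ℝ≥0∞) [Fact (1 ≤ q)] (D : Set (Fin n → ℝ))
    (w : (Fin n → ℝ) → Fin (n + 1) → ℝ) : Prop :=
  ∃ f ∈ W0sub q D, (f : (Fin n → ℝ) → PiLp q (fun _ : Fin (n + 1) => ℝ)) =ᵐ[volume]
    fun x => WithLp.toLp q (w x)

theorem exists_norm_toLp_le (n : ℕ) (q : ℝ≥0∞) [Fact (1 ≤ q)] :
    ∃ C : ℝ, ∀ v : Fin (n + 1) → ℝ, ‖WithLp.toLp q v‖ ≤ C * ‖v‖ :=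
  ⟨_, fun v => (PiLp.continuousLinearEquiv q ℝ
    (fun _ : Fin (n + 1) => ℝ)).symm.toContinuousLinearMap.le_opNorm v⟩

theorem continuous_toLp_pi (n : ℕ) (q : ℝ≥0∞) [Fact (1 ≤ q)] :
    Continuous fun v : Fin (n + 1) → ℝ => WithLp.toLp q v :=
  (PiLp.continuousLinearEquiv q ℝ (fun _ : Fin (n + 1) => ℝ)).symm.continuous

theorem RepresentsW0.of_tendsto (hq : q ≠ ⊤) {w : ℕ → (Fin n → ℝ) → Fin (n + 1) → ℝ}
    {w' : (Fin n → ℝ) → Fin (n + 1) → ℝ} (hw : ∀ k, RepresentsW0 q D (w k))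
    {K : Set (Fin n → ℝ)} (hK : IsCompact K) {B : ℝ}
    (hB : ∀ k x, ‖w k x‖ ≤ B) (hwK : ∀ k, ∀ x ∉ K, w k x = 0)
    (hlim : ∀ x, Tendsto (fun k => w k x) atTop (𝓝 (w' x))) : RepresentsW0 q D w' := by
  have hq0 : q ≠ 0 := (zero_lt_one.trans_le (Fact.out : 1 ≤ q)).ne'
  obtain ⟨C, hC⟩ := exists_norm_toLp_le n q
  choose f hf hfw using hw
  set W : ℕ → (Fin n → ℝ) → PiLp q (fun _ : Fin (n + 1) => ℝ) := fun k x => WithLp.toLp q (w k x)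
    with hW
  set W' : (Fin n → ℝ) → PiLp q (fun _ : Fin (n + 1) => ℝ) := fun x => WithLp.toLp q (w' x) with hW'
  have hWm : ∀ k, AEStronglyMeasurable (W k) volume := fun k =>
    (Lp.aestronglyMeasurable (f k)).congr (hfw k)
  have hWlim : ∀ x, Tendsto (fun k => W k x) atTop (𝓝 (W' x)) := fun x =>
    ((continuous_toLp_pi n q).tendsto _).comp (hlim x)
  have hWm' : AEStronglyMeasurable W' volume :=
    aestronglyMeasurable_of_tendsto_ae atTop hWm (Eventually.of_forall hWlim)
  set g : ℝ → (Fin n → ℝ) → ℝ := fun A => K.indicator fun _ => A with hg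
  have hgm : ∀ A, MemLp (g A) q volume := fun A =>
    memLp_indicator_const q hK.measurableSet A (Or.inr hK.measure_lt_top.ne)
  have hWg : ∀ k x, ‖W k x‖ ≤ g (|C| * B) x := by
    intro k x
    by_cases hx : x ∈ K
    · simp only [hg, indicator_of_mem hx]
      refine (hC _).trans (mul_le_mul (le_abs_self C) (hB k x) (norm_nonneg _) (abs_nonneg _))
    · simp [hg, hx, hW, hwK k x hx]
  have hWg' : ∀ x, ‖W' x‖ ≤ g (|C| * B) x := fun x =>
    le_of_tendsto (hWlim x).norm (Eventually.of_forall fun k => hWg k x)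
  have hmem' : MemLp W' q volume := MemLp.of_le (hgm (|C| * B)) hWm'
    (Eventually.of_forall fun x => (hWg' x).trans (le_abs_self _))
  refine ⟨hmem'.toLp W', ?_, hmem'.coeFn_toLp⟩
  refine (Submodule.isClosed_topologicalClosure _).mem_of_tendsto (f := f) (b := atTop) ?_
    (Eventually.of_forall hf)
  rw [Lp.tendsto_Lp_iff_tendsto_eLpNorm']
  have h := tendsto_eLpNorm_sub_of_dominated hq hq0 hWm hWm' ((hgm (|C| * B)).add (hgm (|C| * B)))
    (fun k => Eventually.of_forall fun x => (norm_sub_le _ _).trans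
      (add_le_add (hWg k x) (hWg' x))) (Eventually.of_forall hWlim)
  refine h.congr fun k => eLpNorm_congr_ae ?_
  filter_upwards [hfw k, hmem'.coeFn_toLp] with x h1 h2
  simp only [Pi.sub_apply, h1, h2, hW]

/-- The jet of a function, as an unnormed tuple. -/
noncomputable def rawJet (u : (Fin n → ℝ) → ℝ) (x : Fin n → ℝ) : Fin (n + 1) → ℝ :=
  Fin.cons (u x) fun i => pder i u x

theorem continuous_rawJet {u : (Fin n → ℝ) → ℝ} (hu : ContDiff ℝ 1 u) :
    Continuous (rawJet u) := by
  refine continuous_pi fun j => ?_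
  refine Fin.cases ?_ (fun i => ?_) j
  · exact hu.continuous
  · exact continuous_pder i hu

theorem rawJet_eq_zero_of_notMem_tsupport {u : (Fin n → ℝ) → ℝ} {x : Fin n → ℝ}
    (hx : x ∉ tsupport u) : rawJet u x = 0 := by
  refine funext fun j => ?_
  refine Fin.cases ?_ (fun i => ?_) j
  · exact image_eq_zero_of_notMem_tsupport (f := u) hx
  · exact image_eq_zero_of_notMem_tsupport (f := pder i u) fun h => hx (tsupport_pder_subset i u h)

theorem RepresentsW0.of_isTestFun {u : (Fin n → ℝ) → ℝ}
    (hu : IsTestFun D u) : RepresentsW0 q D (rawJet u) := by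
  have hu1 : ContDiff ℝ 1 u := hu.1.of_le (by exact_mod_cast le_top)
  have hm : MemLp (fun x => WithLp.toLp q (rawJet u x)) q (volume : Measure (Fin n → ℝ)) := by
    refine Continuous.memLp_of_hasCompactSupport
      ((continuous_toLp_pi n q).comp (continuous_rawJet hu1)) ?_
    refine HasCompactSupport.intro hu.2.1 fun x hx => ?_
    rw [rawJet_eq_zero_of_notMem_tsupport hx]
    rfl
  exact ⟨hm.toLp _, Submodule.le_topologicalClosure _ (Submodule.subset_span
    ⟨u, hu, hm.coeFn_toLp⟩), hm.coeFn_toLp⟩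

end Jets

section Mollification

open scoped Convolution

variable {n : ℕ} {q : ℝ≥0∞} [Fact (1 ≤ q)] {D : Set (Fin n → ℝ)}

theorem pder_convolution_right {f v : (Fin n → ℝ) → ℝ} (hf : LocallyIntegrable f)
    (hv : ContDiff ℝ 1 v) (hvc : HasCompactSupport v) (i : Fin n) (x : Fin n → ℝ) :
    pder i (f ⋆[ContinuousLinearMap.lsmul ℝ ℝ, volume] v) x =
      (f ⋆[ContinuousLinearMap.lsmul ℝ ℝ, volume] pder i v) x := by
  rw [pder, (hvc.hasFDerivAt_convolution_right (ContinuousLinearMap.lsmul ℝ ℝ) hf hv x).fderiv]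
  exact convolution_precompR_apply _ hf (hvc.fderiv ℝ) (hv.continuous_fderiv one_ne_zero) x _

theorem abs_normed_convolution_le {φ : ContDiffBump (0 : Fin n → ℝ)} {g : (Fin n → ℝ) → ℝ}
    (hg : Continuous g) {M : ℝ} (hM : ∀ x, |g x| ≤ M) (x : Fin n → ℝ) :
    |(φ.normed volume ⋆[ContinuousLinearMap.lsmul ℝ ℝ, volume] g) x| ≤ 3 * M := by
  have h := ContDiffBump.dist_normed_convolution_le (φ := φ) (x₀ := x) (ε := 2 * M)
    (μ := volume) hg.aestronglyMeasurable fun y _ => by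
      rw [Real.dist_eq]
      linarith [abs_sub (g y) (g x), hM y, hM x]
  rw [Real.dist_eq] at h
  have h2 := abs_sub_abs_le_abs_sub
    ((φ.normed volume ⋆[ContinuousLinearMap.lsmul ℝ ℝ, volume] g) x) (g x)
  linarith [hM x]

theorem RepresentsW0.of_contDiff_one (hq : q ≠ ⊤) (hD : IsOpen D) {v : (Fin n → ℝ) → ℝ}
    (hv : ContDiff ℝ 1 v) (hvc : HasCompactSupport v) (hvD : tsupport v ⊆ D) :
    RepresentsW0 q D (rawJet v) := by
  obtain ⟨δ, hδ, hδD⟩ := IsCompact.exists_cthickening_subset_open hvc hD hvD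
  let φ : ℕ → ContDiffBump (0 : Fin n → ℝ) := fun k =>
    { rIn := δ * (1 / ((k : ℝ) + 1)) / 2
      rOut := δ * (1 / ((k : ℝ) + 1))
      rIn_pos := by positivity
      rIn_lt_rOut := half_lt_self (by positivity) }
  have hφ0 : Tendsto (fun k => (φ k).rOut) atTop (𝓝 0) := by
    have h := (tendsto_one_div_add_atTop_nhds_zero_nat (𝕜 := ℝ)).const_mul δ
    rwa [mul_zero] at h
  have hφδ : ∀ k, (φ k).rOut ≤ δ := fun k => by
    refine mul_le_of_le_one_right hδ.le ?_
    rw [div_le_one (by positivity)]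
    linarith [Nat.cast_nonneg (α := ℝ) k]
  set K := Metric.cthickening δ (tsupport v) with hK
  have hKc : IsCompact K := IsCompact.cthickening hvc
  let vk : ℕ → (Fin n → ℝ) → ℝ := fun k =>
    (φ k).normed volume ⋆[ContinuousLinearMap.lsmul ℝ ℝ, volume] v
  have hlocφ : ∀ k, LocallyIntegrable ((φ k).normed (volume : Measure (Fin n → ℝ))) := fun k =>
    (φ k).continuous_normed.locallyIntegrable
  have hp : ∀ k i x, pder i (vk k) x =
      ((φ k).normed volume ⋆[ContinuousLinearMap.lsmul ℝ ℝ, volume] pder i v) x := fun k i x =>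
    pder_convolution_right (hlocφ k) hv hvc i x
  have hsupp : ∀ k, tsupport (vk k) ⊆ K := by
    intro k
    refine closure_minimal ?_ Metric.isClosed_cthickening
    refine (support_convolution_subset _).trans ?_
    rw [ContDiffBump.support_normed_eq]
    rintro _ ⟨y, hy, z, hz, rfl⟩
    refine Metric.mem_cthickening_of_dist_le _ z _ _ (subset_tsupport _ hz) ?_
    simpa using (mem_ball_zero_iff.1 hy).le.trans (hφδ k)
  have htest : ∀ k, IsTestFun D (vk k) := fun k =>
    ⟨HasCompactSupport.contDiff_convolution_left _ (φ k).hasCompactSupport_normed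
      (φ k).contDiff_normed hv.continuous.locallyIntegrable,
      hKc.of_isClosed_subset (isClosed_tsupport _) (hsupp k), (hsupp k).trans hδD⟩
  obtain ⟨M, hM⟩ : ∃ M, ∀ x, ‖rawJet v x‖ ≤ M := by
    refine (continuous_rawJet hv).bounded_above_of_compact_support ?_
    exact HasCompactSupport.intro hvc fun x hx => rawJet_eq_zero_of_notMem_tsupport hx
  have hM0 : 0 ≤ M := (norm_nonneg _).trans (hM 0)
  have hMj : ∀ j x, |rawJet v x j| ≤ M := fun j x => (norm_le_pi_norm (rawJet v x) j).trans (hM x)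
  refine RepresentsW0.of_tendsto hq (fun k => RepresentsW0.of_isTestFun (htest k)) hKc
    (B := 3 * M) (fun k x => ?_) (fun k x hx => ?_) fun x => ?_
  · refine (pi_norm_le_iff_of_nonneg (by positivity)).2 fun j => ?_
    refine Fin.cases ?_ (fun i => ?_) j
    · exact abs_normed_convolution_le hv.continuous (hMj 0) x
    · change |pder i (vk k) x| ≤ _
      rw [hp]
      exact abs_normed_convolution_le (continuous_pder i hv) (hMj i.succ) x
  · exact rawJet_eq_zero_of_notMem_tsupport fun h => hx (hsupp k h)
  · refine tendsto_pi_nhds.2 fun j => ?_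
    refine Fin.cases ?_ (fun i => ?_) j
    · exact ContDiffBump.convolution_tendsto_right_of_continuous hφ0 hv.continuous x
    · change Tendsto (fun k => pder i (vk k) x) atTop _
      simp_rw [hp]
      exact ContDiffBump.convolution_tendsto_right_of_continuous hφ0 (continuous_pder i hv) x

end Mollification

theorem hasDerivAt_max_zero_sq (t : ℝ) : HasDerivAt (fun t : ℝ => max t 0 ^ 2) (2 * max t 0) t := by
  have h : ∀ y ≠ (0 : ℝ), HasDerivAt (fun t : ℝ => max t 0 ^ 2) (2 * max y 0) y := by
    intro y hy
    rcases lt_or_gt_of_ne hy with h | h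
    · rw [max_eq_right h.le, mul_zero]
      refine (hasDerivAt_const y (0 : ℝ)).congr_of_eventuallyEq ?_
      filter_upwards [Iio_mem_nhds h] with z hz
      simp [max_eq_right (mem_Iio.1 hz).le]
    · rw [max_eq_left h.le]
      refine (by simpa using hasDerivAt_pow 2 y : HasDerivAt (fun t : ℝ => t ^ 2) (2 * y) y)
        |>.congr_of_eventuallyEq ?_
      filter_upwards [Ioi_mem_nhds h] with z hz
      rw [max_eq_left (mem_Ioi.1 hz).le]
  rcases eq_or_ne t 0 with rfl | ht
  · exact hasDerivAt_of_hasDerivAt_of_ne (g := fun y => 2 * max y 0) (fun y hy => h y hy)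
      (by fun_prop) (by fun_prop)
  · exact h t ht

theorem contDiff_max_zero_sq : ContDiff ℝ 1 fun t : ℝ => max t 0 ^ 2 := by
  rw [contDiff_one_iff_deriv]
  refine ⟨fun t => (hasDerivAt_max_zero_sq t).differentiableAt, ?_⟩
  rw [funext fun t => (hasDerivAt_max_zero_sq t).deriv]
  fun_prop

/-- A `C¹` truncation of the identity on `(0, ∞)`, vanishing on `(0, ε]`. -/
noncomputable def softTrunc (ε t : ℝ) : ℝ := max (t - ε) 0 ^ 2 / t

/-- The derivative of `softTrunc ε` on `(0, ∞)`. -/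
noncomputable def softTruncDeriv (ε t : ℝ) : ℝ :=
  (2 * max (t - ε) 0 * t - max (t - ε) 0 ^ 2) / t ^ 2

theorem hasDerivAt_softTrunc (ε : ℝ) {t : ℝ} (ht : 0 < t) :
    HasDerivAt (softTrunc ε) (softTruncDeriv ε t) t := by
  have h1 : HasDerivAt (fun t : ℝ => max (t - ε) 0 ^ 2) (2 * max (t - ε) 0) t := by
    simpa using (hasDerivAt_max_zero_sq (t - ε)).comp_sub_const t ε
  refine (h1.div (hasDerivAt_id t) ht.ne').congr_deriv ?_
  simp [softTruncDeriv]

theorem contDiffAt_softTrunc (ε : ℝ) {t : ℝ} (ht : 0 < t) : ContDiffAt ℝ 1 (softTrunc ε) t :=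
  (contDiff_max_zero_sq.comp (contDiff_id.sub contDiff_const)).contDiffAt.div contDiffAt_id ht.ne'

theorem softTrunc_nonneg (ε : ℝ) {t : ℝ} (ht : 0 < t) : 0 ≤ softTrunc ε t := by
  unfold softTrunc; positivity

theorem max_sub_le {ε t : ℝ} (hε : 0 ≤ ε) (ht : 0 < t) : max (t - ε) 0 ≤ t :=
  max_le (by linarith) ht.le

theorem softTrunc_le {ε : ℝ} (hε : 0 ≤ ε) {t : ℝ} (ht : 0 < t) : softTrunc ε t ≤ t := by
  rw [softTrunc, div_le_iff₀ ht]
  nlinarith [max_sub_le hε ht, le_max_right (t - ε) 0]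

theorem softTrunc_of_le {ε t : ℝ} (h : t ≤ ε) : softTrunc ε t = 0 := by
  simp [softTrunc, max_eq_right (sub_nonpos.2 h)]

theorem abs_softTruncDeriv_le_one {ε : ℝ} (hε : 0 ≤ ε) {t : ℝ} (ht : 0 < t) :
    |softTruncDeriv ε t| ≤ 1 := by
  have h0 := le_max_right (t - ε) 0
  have h1 := max_sub_le hε ht
  rw [softTruncDeriv, abs_of_nonneg (div_nonneg (by nlinarith) (by positivity)),
    div_le_one (by positivity)]
  nlinarith [sq_nonneg (t - max (t - ε) 0)]

theorem tendsto_softTrunc {ι : Type*} {l : Filter ι} {ε : ι → ℝ} (hε : Tendsto ε l (𝓝 0)) {t : ℝ}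
    (ht : 0 < t) : Tendsto (fun k => softTrunc (ε k) t) l (𝓝 t) := by
  have h : Continuous fun e : ℝ => softTrunc e t := by unfold softTrunc; fun_prop
  have h' := (h.tendsto 0).comp hε
  have e : softTrunc 0 t = t := by
    rw [softTrunc, sub_zero, max_eq_left ht.le, sq, mul_div_assoc, div_self ht.ne', mul_one]
  rwa [e] at h'

theorem tendsto_softTruncDeriv {ι : Type*} {l : Filter ι} {ε : ι → ℝ} (hε : Tendsto ε l (𝓝 0))
    {t : ℝ} (ht : 0 < t) : Tendsto (fun k => softTruncDeriv (ε k) t) l (𝓝 1) := by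
  have h : Continuous fun e : ℝ => softTruncDeriv e t := by unfold softTruncDeriv; fun_prop
  have h' := (h.tendsto 0).comp hε
  have e : softTruncDeriv 0 t = 1 := by
    rw [softTruncDeriv, sub_zero, max_eq_left ht.le]
    field_simp
    ring
  rwa [e] at h'

section Rectangle

variable {n : ℕ} {p : ℝ} {μ a b : Fin n → ℝ} {s c : Fin n → ℝ → ℝ}

theorem prod_profile_eq_zero (hs : ∀ i, IsDirichletProfile p (μ i) (a i) (b i) (s i) (c i))
    {x : Fin n → ℝ} (hx : x ∈ Icc a b) (hxD : x ∉ stripDomain n 0 a b) :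
    ∏ i, s i (x i) = 0 := by
  rw [mem_stripDomain_zero] at hxD
  push Not at hxD
  obtain ⟨i, hi⟩ := hxD
  refine Finset.prod_eq_zero (Finset.mem_univ i) ?_
  rcases (hx.1 i).eq_or_lt with h | h
  · rw [← h, (hs i).left]
  · rcases (hx.2 i).eq_or_lt with h' | h'
    · rw [h', (hs i).right]
    · exact absurd ⟨h, h'⟩ hi

theorem prod_profile_le_one (hs : ∀ i, IsDirichletProfile p (μ i) (a i) (b i) (s i) (c i))
    {x : Fin n → ℝ} (hx : x ∈ stripDomain n 0 a b) (t : Finset (Fin n)) :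
    ∏ i ∈ t, s i (x i) ≤ 1 :=
  Finset.prod_le_one (fun i _ => ((hs i).pos _ (mem_stripDomain_zero.1 hx i)).le)
    fun i _ => (hs i).le_one _ (mem_stripDomain_zero.1 hx i)

theorem exists_abs_pder_prod_profile_le
    (hs : ∀ i, IsDirichletProfile p (μ i) (a i) (b i) (s i) (c i)) :
    ∃ M, 1 ≤ M ∧ ∀ i, ∀ x ∈ stripDomain n 0 a b,
      |pder i (fun x : Fin n → ℝ => ∏ j, s j (x j)) x| ≤ M := by
  choose M hM using fun i => (hs i).bdd_deriv
  refine ⟨1 + ∑ i, |M i|, le_add_of_nonneg_right (Finset.sum_nonneg fun i _ => abs_nonneg _),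
    fun i x hx => ?_⟩
  have hxi := mem_stripDomain_zero.1 hx
  have hpos : 0 < ∏ j ∈ Finset.univ.erase i, s j (x j) :=
    Finset.prod_pos fun j _ => (hs j).pos _ (hxi j)
  rw [pder_prod_profile hs i hx, abs_mul, abs_of_pos hpos]
  have h1 : |M i| ≤ ∑ i, |M i| :=
    Finset.single_le_sum (f := fun i => |M i|) (fun i _ => abs_nonneg _) (Finset.mem_univ i)
  calc _ ≤ 1 * |c i (x i)| :=
        mul_le_mul_of_nonneg_right (prod_profile_le_one hs hx _) (abs_nonneg _)
    _ ≤ 1 + ∑ i, |M i| := by linarith [hM i _ (hxi i), le_abs_self (M i)]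

theorem IsDirichletProfile.contDiffAt {p μ a b : ℝ} {s c : ℝ → ℝ}
    (hs : IsDirichletProfile p μ a b s c) {t : ℝ} (ht : t ∈ Ioo a b) : ContDiffAt ℝ 1 s t := by
  have h : ContDiffOn ℝ 1 s (Ioo a b) := by
    rw [show (1 : WithTop ℕ∞) = 0 + 1 by simp, contDiffOn_succ_iff_deriv_of_isOpen isOpen_Ioo]
    refine ⟨fun t ht => (hs.hasDeriv t ht).differentiableAt.differentiableWithinAt, by simp, ?_⟩
    rw [contDiffOn_zero]
    exact hs.cont_deriv.congr fun t ht => (hs.hasDeriv t ht).deriv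
  exact h.contDiffAt (Ioo_mem_nhds ht.1 ht.2)

theorem contDiffAt_prod_profile (hs : ∀ i, IsDirichletProfile p (μ i) (a i) (b i) (s i) (c i))
    {x : Fin n → ℝ} (hx : x ∈ stripDomain n 0 a b) :
    ContDiffAt ℝ 1 (fun x : Fin n → ℝ => ∏ j, s j (x j)) x :=
  contDiffAt_prod fun j _ => ((hs j).contDiffAt (mem_stripDomain_zero.1 hx j)).comp x
    (contDiff_apply ℝ ℝ j).contDiffAt

/-- The truncated product, a `C¹` function with compact support in the rectangle. -/
noncomputable def truncProd (a b : Fin n → ℝ) (s : Fin n → ℝ → ℝ) (ε : ℝ) : (Fin n → ℝ) → ℝ :=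
  (stripDomain n 0 a b).indicator fun x => softTrunc ε (∏ j, s j (x j))

theorem tsupport_truncProd_subset
    (hs : ∀ i, IsDirichletProfile p (μ i) (a i) (b i) (s i) (c i)) {ε : ℝ} (hε : 0 < ε) :
    tsupport (truncProd a b s ε) ⊆ stripDomain n 0 a b := by
  have hc : ContinuousOn (fun x : Fin n → ℝ => ∏ j, s j (x j)) (Icc a b) :=
    continuousOn_finsetProd _ fun j _ => (hs j).cont.comp (continuous_apply j).continuousOn
      fun x hx => ⟨hx.1 j, hx.2 j⟩
  have hcl := hc.preimage_isClosed_of_isClosed isClosed_Icc (isClosed_Ici (a := ε))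
  refine (closure_minimal (t := Icc a b ∩ (fun x : Fin n → ℝ => ∏ j, s j (x j)) ⁻¹' Ici ε)
    ?_ hcl).trans ?_
  · intro x hx
    have hxD : x ∈ stripDomain n 0 a b := mem_of_indicator_ne_zero hx
    refine ⟨stripDomain_zero_subset_Icc a b hxD, ?_⟩
    by_contra h
    exact hx (by rw [truncProd, indicator_of_mem hxD, softTrunc_of_le (not_le.1 h).le])
  · rintro x ⟨hx, hxε⟩
    by_contra h
    have := prod_profile_eq_zero hs hx h
    exact absurd hxε (by simp [this, hε])

theorem hasCompactSupport_truncProd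
    (hs : ∀ i, IsDirichletProfile p (μ i) (a i) (b i) (s i) (c i)) {ε : ℝ} (hε : 0 < ε) :
    HasCompactSupport (truncProd a b s ε) :=
  isCompact_Icc.of_isClosed_subset (isClosed_tsupport _)
    ((tsupport_truncProd_subset hs hε).trans (stripDomain_zero_subset_Icc a b))

theorem truncProd_eventuallyEq {ε : ℝ} {x : Fin n → ℝ} (hx : x ∈ stripDomain n 0 a b) :
    truncProd a b s ε =ᶠ[𝓝 x] fun x => softTrunc ε (∏ j, s j (x j)) := by
  filter_upwards [(isOpen_stripDomain_zero a b).mem_nhds hx] with y hy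
  exact indicator_of_mem hy _

theorem contDiff_truncProd
    (hs : ∀ i, IsDirichletProfile p (μ i) (a i) (b i) (s i) (c i)) {ε : ℝ} (hε : 0 < ε) :
    ContDiff ℝ 1 (truncProd a b s ε) := by
  refine contDiff_iff_contDiffAt.2 fun x => ?_
  by_cases hx : x ∈ tsupport (truncProd a b s ε)
  swap
  · exact contDiffAt_const.congr_of_eventuallyEq (notMem_tsupport_iff_eventuallyEq.1 hx)
  have hxD := tsupport_truncProd_subset hs hε hx
  exact ((contDiffAt_softTrunc ε (prod_profile_pos hs hxD)).comp x
    (contDiffAt_prod_profile hs hxD)).congr_of_eventuallyEq (truncProd_eventuallyEq hxD)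

theorem pder_truncProd (hs : ∀ i, IsDirichletProfile p (μ i) (a i) (b i) (s i) (c i)) {ε : ℝ}
    (i : Fin n) {x : Fin n → ℝ} (hx : x ∈ stripDomain n 0 a b) :
    pder i (truncProd a b s ε) x = softTruncDeriv ε (∏ j, s j (x j)) *
      pder i (fun x : Fin n → ℝ => ∏ j, s j (x j)) x := by
  have h := (hasDerivAt_softTrunc ε (prod_profile_pos hs hx)).comp_hasFDerivAt x
    ((contDiffAt_prod_profile hs hx).differentiableAt one_ne_zero).hasFDerivAt
  rw [pder, (h.congr_of_eventuallyEq (truncProd_eventuallyEq hx)).fderiv]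
  simp [pder]

theorem pder_truncProd_of_notMem
    (hs : ∀ i, IsDirichletProfile p (μ i) (a i) (b i) (s i) (c i)) {ε : ℝ} (hε : 0 < ε)
    (i : Fin n) {x : Fin n → ℝ} (hx : x ∉ stripDomain n 0 a b) :
    pder i (truncProd a b s ε) x = 0 :=
  image_eq_zero_of_notMem_tsupport fun h =>
    hx (tsupport_truncProd_subset hs hε (tsupport_pder_subset i _ h))

theorem abs_truncProd_le_one (hs : ∀ i, IsDirichletProfile p (μ i) (a i) (b i) (s i) (c i))
    {ε : ℝ} (hε : 0 ≤ ε) (x : Fin n → ℝ) : |truncProd a b s ε x| ≤ 1 := by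
  by_cases hx : x ∈ stripDomain n 0 a b
  · have hP := prod_profile_pos hs hx
    rw [truncProd, indicator_of_mem hx, abs_of_nonneg (softTrunc_nonneg ε hP)]
    exact (softTrunc_le hε hP).trans (prod_profile_le_one hs hx _)
  · simp [truncProd, hx]

theorem tendsto_truncProd (hs : ∀ i, IsDirichletProfile p (μ i) (a i) (b i) (s i) (c i))
    {ε : ℕ → ℝ} (hε : Tendsto ε atTop (𝓝 0)) (x : Fin n → ℝ) :
    Tendsto (fun k => truncProd a b s (ε k) x) atTop
      (𝓝 ((stripDomain n 0 a b).indicator (fun x => ∏ j, s j (x j)) x)) := by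
  by_cases hx : x ∈ stripDomain n 0 a b
  · simpa [truncProd, hx] using tendsto_softTrunc hε (prod_profile_pos hs hx)
  · simp [truncProd, hx]

theorem tendsto_pder_truncProd (hs : ∀ i, IsDirichletProfile p (μ i) (a i) (b i) (s i) (c i))
    {ε : ℕ → ℝ} (hε0 : ∀ k, 0 < ε k) (hε : Tendsto ε atTop (𝓝 0)) (i : Fin n) (x : Fin n → ℝ) :
    Tendsto (fun k => pder i (truncProd a b s (ε k)) x) atTop
      (𝓝 ((stripDomain n 0 a b).indicator
        (pder i fun x : Fin n → ℝ => ∏ j, s j (x j)) x)) := by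
  by_cases hx : x ∈ stripDomain n 0 a b
  · simp_rw [indicator_of_mem hx, pder_truncProd hs i hx]
    simpa using (tendsto_softTruncDeriv hε (prod_profile_pos hs hx)).mul_const
      (pder i (fun x : Fin n → ℝ => ∏ j, s j (x j)) x)
  · simp_rw [indicator_of_notMem hx, pder_truncProd_of_notMem hs (hε0 _) i hx]
    exact tendsto_const_nhds

theorem abs_pder_truncProd_le (hs : ∀ i, IsDirichletProfile p (μ i) (a i) (b i) (s i) (c i))
    {ε M : ℝ} (hε : 0 < ε) (hM0 : 0 ≤ M) (i : Fin n)
    (hM : ∀ x ∈ stripDomain n 0 a b, |pder i (fun x : Fin n → ℝ => ∏ j, s j (x j)) x| ≤ M)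
    (x : Fin n → ℝ) : |pder i (truncProd a b s ε) x| ≤ M := by
  by_cases hx : x ∈ stripDomain n 0 a b
  · rw [pder_truncProd hs i hx, abs_mul]
    exact (mul_le_of_le_one_left (abs_nonneg _)
      (abs_softTruncDeriv_le_one hε.le (prod_profile_pos hs hx))).trans (hM x hx)
  · rwa [pder_truncProd_of_notMem hs hε i hx, abs_zero]

/-- The product of the profiles, extended by zero, belongs to `W₀^{1,q}` of the rectangle. -/
theorem representsW0_prod_profile {q : ℝ≥0∞} [Fact (1 ≤ q)] (hq : q ≠ ⊤)
    (hs : ∀ i, IsDirichletProfile p (μ i) (a i) (b i) (s i) (c i)) :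
    RepresentsW0 q (stripDomain n 0 a b) fun x => Fin.cons
      ((stripDomain n 0 a b).indicator (fun x => ∏ j, s j (x j)) x) fun i =>
        (stripDomain n 0 a b).indicator (pder i fun x : Fin n → ℝ => ∏ j, s j (x j)) x := by
  obtain ⟨M, hM1, hM⟩ := exists_abs_pder_prod_profile_le hs
  set ε : ℕ → ℝ := fun k => 1 / ((k : ℝ) + 1) with hε
  have hε0 : ∀ k, 0 < ε k := fun k => by positivity
  have hεl : Tendsto ε atTop (𝓝 0) := tendsto_one_div_add_atTop_nhds_zero_nat
  refine RepresentsW0.of_tendsto hq (w := fun k => rawJet (truncProd a b s (ε k)))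
    (fun k => RepresentsW0.of_contDiff_one hq (isOpen_stripDomain_zero a b)
      (contDiff_truncProd hs (hε0 k)) (hasCompactSupport_truncProd hs (hε0 k))
      (tsupport_truncProd_subset hs (hε0 k))) isCompact_Icc (B := M) (K := Icc a b)
      (fun k x => ?_) (fun k x hx => ?_) fun x => ?_
  · refine (pi_norm_le_iff_of_nonneg (by linarith)).2 fun j => ?_
    refine Fin.cases ?_ (fun i => ?_) j
    · exact (abs_truncProd_le_one hs (hε0 k).le x).trans hM1
    · exact abs_pder_truncProd_le hs (hε0 k) (by linarith) i (hM i) x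
  · exact rawJet_eq_zero_of_notMem_tsupport fun h => hx
      (stripDomain_zero_subset_Icc a b (tsupport_truncProd_subset hs (hε0 k) h))
  · refine tendsto_pi_nhds.2 fun j => ?_
    refine Fin.cases ?_ (fun i => ?_) j
    · exact tendsto_truncProd hs hεl x
    · exact tendsto_pder_truncProd hs hε0 hεl i x

/-- Energy identity, one direction at a time. -/
theorem setIntegral_abs_pder_rpow (hp : 1 < p)
    (hs : ∀ i, IsDirichletProfile p (μ i) (a i) (b i) (s i) (c i)) (i : Fin n) :
    ∫ x in stripDomain n 0 a b, |pder i (fun x : Fin n → ℝ => ∏ j, s j (x j)) x| ^ p =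
      μ i * ∫ x in stripDomain n 0 a b, |∏ j, s j (x j)| ^ p := by
  obtain ⟨M, hM1, hM⟩ := exists_abs_pder_prod_profile_le hs
  set D := stripDomain n 0 a b with hD
  set ε : ℕ → ℝ := fun k => 1 / ((k : ℝ) + 1) with hε
  have hε0 : ∀ k, 0 < ε k := fun k => by positivity
  have hεl : Tendsto ε atTop (𝓝 0) := tendsto_one_div_add_atTop_nhds_zero_nat
  have hDm : MeasurableSet D := (isOpen_stripDomain_zero a b).measurableSet
  have hDfin : volume D < ⊤ :=
    (measure_mono (stripDomain_zero_subset_Icc a b)).trans_lt isCompact_Icc.measure_lt_top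
  set P : (Fin n → ℝ) → ℝ := fun x => ∏ j, s j (x j) with hP
  have hPc : ContinuousOn P D := continuousOn_prod_profile hs _
  have hPd : ContinuousOn (pder i P) D := continuousOn_pder_prod_profile hs i
  have habs : ∀ y : ℝ, |y| ^ (p - 2) * y * y = |y| ^ p := fun y => by
    rcases eq_or_ne y 0 with h | h
    · simp [h, Real.zero_rpow (by linarith : p ≠ 0)]
    · rw [mul_assoc, ← abs_mul_abs_self, ← mul_assoc, ← Real.rpow_add_one (abs_pos.2 h).ne',
        ← Real.rpow_add_one (abs_pos.2 h).ne']
      congr 1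
      ring
  have habs' : ∀ y : ℝ, |(|y| ^ (p - 2) * y)| = |y| ^ (p - 1) := fun y => by
    rw [abs_mul, abs_of_nonneg (Real.rpow_nonneg (abs_nonneg _) _)]
    rcases eq_or_ne y 0 with h | h
    · simp [h, Real.zero_rpow (by linarith : p - 1 ≠ 0)]
    · rw [← Real.rpow_add_one (abs_pos.2 h).ne']; congr 1; ring
  have hPdm : AEMeasurable (pder i P) (volume.restrict D) := hPd.aemeasurable hDm
  have hL : Tendsto (fun k => ∫ x in D, |pder i P x| ^ (p - 2) * pder i P x *
      pder i (truncProd a b s (ε k)) x) atTop (𝓝 (∫ x in D, |pder i P x| ^ p)) := by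
    refine tendsto_integral_of_dominated_convergence (fun _ => M ^ (p - 1) * M) (fun k => ?_)
      (integrableOn_const hDfin.ne) (fun k => ?_) ?_
    · exact (((hPdm.abs.pow_const _).mul hPdm).mul
        (continuous_pder i (contDiff_truncProd hs (hε0 k))).aemeasurable).aestronglyMeasurable
    · filter_upwards [ae_restrict_mem hDm] with x hx
      rw [Real.norm_eq_abs, abs_mul, habs']
      exact mul_le_mul (Real.rpow_le_rpow (abs_nonneg _) (hM i x hx) (by linarith))
        (abs_pder_truncProd_le hs (hε0 k) (by linarith) i (hM i) x) (abs_nonneg _)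
        (Real.rpow_nonneg (by linarith) _)
    · filter_upwards [ae_restrict_mem hDm] with x hx
      have := (tendsto_pder_truncProd hs hε0 hεl i x).const_mul
        (|pder i P x| ^ (p - 2) * pder i P x)
      rwa [indicator_of_mem hx, habs] at this
  have hR : Tendsto (fun k => μ i * ∫ x in D, P x ^ (p - 1) * truncProd a b s (ε k) x) atTop
      (𝓝 (μ i * ∫ x in D, |P x| ^ p)) := by
    refine (tendsto_integral_of_dominated_convergence (fun _ => 1) (fun k => ?_)
      (integrableOn_const hDfin.ne) (fun k => ?_) ?_).const_mul _
    · exact (((hPc.aemeasurable hDm).pow_const _).mul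
        (contDiff_truncProd hs (hε0 k)).continuous.aemeasurable).aestronglyMeasurable
    · filter_upwards [ae_restrict_mem hDm] with x hx
      have hx0 := prod_profile_pos hs hx
      rw [Real.norm_eq_abs, abs_mul, abs_of_nonneg (Real.rpow_nonneg hx0.le _)]
      exact mul_le_one₀ (Real.rpow_le_one hx0.le (prod_profile_le_one hs hx _) (by linarith))
        (abs_nonneg _) (abs_truncProd_le_one hs (hε0 k).le x)
    · filter_upwards [ae_restrict_mem hDm] with x hx
      have hx0 := prod_profile_pos hs hx
      have := (tendsto_truncProd hs hεl x).const_mul (P x ^ (p - 1))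
      rw [indicator_of_mem hx] at this
      convert this using 2
      rw [abs_of_pos hx0]
      change P x ^ p = P x ^ (p - 1) * P x
      rw [← Real.rpow_add_one (ne_of_gt hx0), sub_add_cancel]
  refine tendsto_nhds_unique hL (hR.congr fun k => ?_)
  exact (integral_flux_mul_pder hs i (contDiff_truncProd hs (hε0 k))
    (hasCompactSupport_truncProd hs (hε0 k)) (tsupport_truncProd_subset hs (hε0 k))).symm

end Rectangle

section W0

variable {n : ℕ} {q : ℝ≥0∞} {D : Set (Fin n → ℝ)}

theorem IsTestFun.contDiff_one {u : (Fin n → ℝ) → ℝ} (hu : IsTestFun D u) : ContDiff ℝ 1 u :=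
  hu.1.of_le (by exact_mod_cast le_top)

theorem IsTestFun.add {u v : (Fin n → ℝ) → ℝ} (hu : IsTestFun D u) (hv : IsTestFun D v) :
    IsTestFun D (u + v) :=
  ⟨hu.1.add hv.1, hu.2.1.add hv.2.1,
    (tsupport_add u v).trans (union_subset hu.2.2 hv.2.2)⟩

theorem IsTestFun.const_smul {u : (Fin n → ℝ) → ℝ} (hu : IsTestFun D u) (r : ℝ) :
    IsTestFun D (r • u) :=
  ⟨contDiff_const.smul hu.1, hu.2.1.smul_left (f := fun _ => r),
    (tsupport_smul_subset_right (fun _ => r) u).trans hu.2.2⟩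

theorem jet_eq (u : (Fin n → ℝ) → ℝ) (x : Fin n → ℝ) :
    jet q u x = WithLp.toLp q (rawJet u x) := rfl

theorem jet_add {u v : (Fin n → ℝ) → ℝ} (hu : Differentiable ℝ u) (hv : Differentiable ℝ v)
    (x : Fin n → ℝ) : jet q (u + v) x = jet q u x + jet q v x := by
  rw [jet_eq, jet_eq, jet_eq, ← WithLp.toLp_add]
  congr 1
  refine funext fun j => ?_
  refine Fin.cases rfl (fun i => ?_) j
  simp [rawJet, pder, fderiv_add (hu x) (hv x)]

theorem jet_const_smul {u : (Fin n → ℝ) → ℝ} (hu : Differentiable ℝ u) (r : ℝ)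
    (x : Fin n → ℝ) : jet q (r • u) x = r • jet q u x := by
  rw [jet_eq, jet_eq, ← WithLp.toLp_smul]
  congr 1
  refine funext fun j => ?_
  refine Fin.cases rfl (fun i => ?_) j
  simp [rawJet, pder, fderiv_const_smul (hu x)]

variable [Fact (1 ≤ q)]

theorem exists_isTestFun_of_mem_span {f : Vsp n q}
    (hf : f ∈ Submodule.span ℝ {f : Vsp n q | ∃ u : (Fin n → ℝ) → ℝ, IsTestFun D u ∧
      (f : (Fin n → ℝ) → PiLp q (fun _ : Fin (n + 1) => ℝ)) =ᵐ[volume] jet q u}) :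
    ∃ u, IsTestFun D u ∧
      (f : (Fin n → ℝ) → PiLp q (fun _ : Fin (n + 1) => ℝ)) =ᵐ[volume] jet q u := by
  induction hf using Submodule.span_induction with
  | mem f hf => exact hf
  | zero =>
    refine ⟨0, ⟨contDiff_const, HasCompactSupport.zero, by simp [tsupport]⟩, ?_⟩
    filter_upwards [Lp.coeFn_zero (PiLp q (fun _ : Fin (n + 1) => ℝ)) q
      (volume : Measure (Fin n → ℝ))] with x hx
    rw [hx, jet_eq, rawJet_eq_zero_of_notMem_tsupport (by simp [tsupport])]
    rfl
  | add f g _ _ hf hg =>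
    obtain ⟨u, hu, hfu⟩ := hf
    obtain ⟨v, hv, hgv⟩ := hg
    refine ⟨u + v, hu.add hv, ?_⟩
    filter_upwards [Lp.coeFn_add f g, hfu, hgv] with x h1 h2 h3
    rw [h1, Pi.add_apply, h2, h3, jet_add (hu.contDiff_one.differentiable one_ne_zero)
      (hv.contDiff_one.differentiable one_ne_zero)]
  | smul r f _ hf =>
    obtain ⟨u, hu, hfu⟩ := hf
    refine ⟨r • u, hu.const_smul r, ?_⟩
    filter_upwards [Lp.coeFn_smul r f, hfu] with x h1 h2
    rw [h1, Pi.smul_apply, h2, jet_const_smul (hu.contDiff_one.differentiable one_ne_zero)]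

/-- A closed condition satisfied by jets of test functions holds on all of `W₀^{1,q}`. -/
theorem W0sub_induction {S : Set (Vsp n q)} (hS : IsClosed S)
    (h : ∀ (f : Vsp n q) (u : (Fin n → ℝ) → ℝ), IsTestFun D u →
      (f : (Fin n → ℝ) → PiLp q (fun _ : Fin (n + 1) => ℝ)) =ᵐ[volume] jet q u → f ∈ S)
    {f : Vsp n q} (hf : f ∈ W0sub q D) : f ∈ S := by
  refine closure_minimal (fun g hg => ?_) hS hf
  obtain ⟨u, hu, hgu⟩ := exists_isTestFun_of_mem_span hg
  exact h g u hu hgu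

theorem continuous_integral_apply_mul (j : Fin (n + 1)) {ψ : (Fin n → ℝ) → ℝ} (hψ : Continuous ψ)
    (hψc : HasCompactSupport ψ) : Continuous fun f : Vsp n q => ∫ x, f x j * ψ x := by
  have : Fact (1 ≤ ENNReal.conjExponent q) := ⟨by simp [ENNReal.conjExponent]⟩
  let L : PiLp q (fun _ : Fin (n + 1) => ℝ) →L[ℝ] ℝ := (ContinuousLinearMap.proj j).comp
    (PiLp.continuousLinearEquiv q ℝ (fun _ : Fin (n + 1) => ℝ)).toContinuousLinearMap
  have hm : MemLp ψ (ENNReal.conjExponent q) (volume : Measure (Fin n → ℝ)) :=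
    hψ.memLp_of_hasCompactSupport hψc
  have h := (((ContinuousLinearMap.mul ℝ ℝ).lpPairing volume q (ENNReal.conjExponent q)).flip
    (hm.toLp ψ)).continuous.comp (L.compLpL q (volume : Measure (Fin n → ℝ))).continuous
  refine h.congr fun f => ?_
  simp only [Function.comp_apply, ContinuousLinearMap.flip_apply,
    ContinuousLinearMap.lpPairing_eq_integral]
  refine integral_congr_ae ?_
  filter_upwards [L.coeFn_compLpL f, hm.coeFn_toLp] with x h1 h2
  rw [h1, h2]
  rfl

/-- The gradient part of an element of `W₀^{1,q}` is the weak gradient of its function part. -/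
theorem integral_apply_succ_mul {f : Vsp n q} (hf : f ∈ W0sub q D) (i : Fin n)
    {ψ : (Fin n → ℝ) → ℝ} (hψ : ContDiff ℝ 1 ψ) (hψc : HasCompactSupport ψ) :
    ∫ x, f x i.succ * ψ x = -∫ x, f x 0 * pder i ψ x := by
  refine W0sub_induction (S := {f | ∫ x, f x i.succ * ψ x = -∫ x, f x 0 * pder i ψ x})
    (isClosed_eq (continuous_integral_apply_mul _ hψ.continuous hψc)
      (continuous_integral_apply_mul _ (continuous_pder i hψ) (hψc.pder i)).neg)
    (fun f u hu hfu => ?_) hf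
  have h := integral_mul_pder (D := univ) i
    (fun x _ => hu.contDiff_one.differentiable one_ne_zero x)
    (continuous_pder i hu.contDiff_one).continuousOn hψ hψc (subset_univ _)
  have e1 : ∫ x, f x i.succ * ψ x = ∫ x, pder i u x * ψ x :=
    integral_congr_ae (by filter_upwards [hfu] with x hx; rw [hx]; rfl)
  have e2 : ∫ x, f x 0 * pder i ψ x = ∫ x, u x * pder i ψ x :=
    integral_congr_ae (by filter_upwards [hfu] with x hx; rw [hx]; rfl)
  change ∫ x, f x i.succ * ψ x = -∫ x, f x 0 * pder i ψ x
  rw [e1, e2, h, neg_neg]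

theorem sobolevEmb_coeFn (f : W0sub q D) :
    ∀ᵐ x, SobolevEmb q D f x = (f : Vsp n q) x 0 :=
  (proj0 n q).coeFn_compLpL (f : Vsp n q)

theorem sobolevGrad_coeFn (f : W0sub q D) :
    ∀ᵐ x, SobolevGrad q D f x = WithLp.toLp q fun i : Fin n => (f : Vsp n q) x i.succ :=
  (projGrad n q).coeFn_compLpL (f : Vsp n q)

theorem sobolevEmb_injective : Function.Injective (SobolevEmb (n := n) q D) := by
  rw [injective_iff_map_eq_zero]
  intro f hf
  have h0 : ∀ᵐ x, (f : Vsp n q) x 0 = 0 := by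
    filter_upwards [sobolevEmb_coeFn f, Lp.coeFn_zero ℝ q (volume : Measure (Fin n → ℝ))]
      with x h1 h2
    rw [← h1, hf, h2, Pi.zero_apply]
  have hi : ∀ i : Fin n, ∀ᵐ x, (f : Vsp n q) x i.succ = 0 := by
    intro i
    let L : PiLp q (fun _ : Fin (n + 1) => ℝ) →L[ℝ] ℝ := (ContinuousLinearMap.proj i.succ).comp
      (PiLp.continuousLinearEquiv q ℝ (fun _ : Fin (n + 1) => ℝ)).toContinuousLinearMap
    have hm : MemLp (fun x => (f : Vsp n q) x i.succ) q volume :=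
      L.comp_memLp' (Lp.memLp (f : Vsp n q))
    refine ae_eq_zero_of_integral_contDiff_smul_eq_zero (hm.locallyIntegrable Fact.out)
      fun ψ hψ hψc => ?_
    have h := integral_apply_succ_mul f.2 i (hψ.of_le (by exact_mod_cast le_top)) hψc
    have e : ∫ x, (f : Vsp n q) x 0 * pder i ψ x = 0 := by
      rw [← integral_zero (Fin n → ℝ) ℝ]
      refine integral_congr_ae ?_
      filter_upwards [h0] with x hx
      rw [hx, zero_mul]
    simp_rw [smul_eq_mul, mul_comm (ψ _)]
    rw [h, e, neg_zero]
  refine Subtype.ext ?_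
  rw [Submodule.coe_zero, Lp.eq_zero_iff_ae_eq_zero]
  filter_upwards [h0, ae_all_iff.2 hi] with x h1 h2
  refine PiLp.ext fun j => ?_
  exact Fin.cases h1 h2 j

theorem Lp_norm_rpow_toReal {α E : Type*} [MeasurableSpace α] {ν : Measure α}
    [NormedAddCommGroup E] (hq : q ≠ ⊤) (f : Lp E q ν) :
    ‖f‖ ^ q.toReal = ∫ x, ‖f x‖ ^ q.toReal ∂ν := by
  have hq0 : q ≠ 0 := (zero_lt_one.trans_le (Fact.out : 1 ≤ q)).ne'
  have h0 : 0 ≤ ∫ x, ‖f x‖ ^ q.toReal ∂ν :=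
    integral_nonneg fun x => Real.rpow_nonneg (norm_nonneg _) _
  rw [Lp.norm_def, (Lp.memLp f).eLpNorm_eq_integral_rpow_norm hq0 hq,
    ENNReal.toReal_ofReal (Real.rpow_nonneg h0 _), ← Real.rpow_mul h0,
    inv_mul_cancel₀ (toReal_pos hq0 hq).ne', Real.rpow_one]

theorem norm_sobolevEmb_rpow (hq : q ≠ ⊤) (f : W0sub q D) :
    ‖SobolevEmb q D f‖ ^ q.toReal = ∫ x, |(f : Vsp n q) x 0| ^ q.toReal := by
  rw [Lp_norm_rpow_toReal hq]
  refine integral_congr_ae ?_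
  filter_upwards [sobolevEmb_coeFn f] with x hx
  rw [hx, Real.norm_eq_abs]

theorem norm_sobolevGrad_rpow (hq : q ≠ ⊤) (f : W0sub q D) :
    ‖SobolevGrad q D f‖ ^ q.toReal =
      ∫ x, ∑ i : Fin n, |(f : Vsp n q) x i.succ| ^ q.toReal := by
  have hq0 : q ≠ 0 := (zero_lt_one.trans_le (Fact.out : 1 ≤ q)).ne'
  have hr := toReal_pos hq0 hq
  rw [Lp_norm_rpow_toReal hq]
  refine integral_congr_ae ?_
  filter_upwards [sobolevGrad_coeFn f] with x hx
  rw [hx, PiLp.norm_eq_sum hr, ← Real.rpow_mul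
    (Finset.sum_nonneg fun i _ => Real.rpow_nonneg (norm_nonneg _) _),
    one_div_mul_cancel hr.ne', Real.rpow_one]
  rfl

theorem isClosed_mul_norm_rpow_le (r : ℝ) :
    IsClosed {f : Vsp n q | r * ‖(proj0 n q).compLpL q volume f‖ ^ q.toReal ≤
      ‖(projGrad n q).compLpL q volume f‖ ^ q.toReal} := by
  refine isClosed_le (continuous_const.mul (Continuous.rpow_const ?_ fun _ => Or.inr ?_))
    (Continuous.rpow_const ?_ fun _ => Or.inr ?_)
  · exact (ContinuousLinearMap.continuous _).norm
  · exact toReal_nonneg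
  · exact (ContinuousLinearMap.continuous _).norm
  · exact toReal_nonneg

end W0

section Rectangle

variable {n : ℕ} {q : ℝ≥0∞} [Fact (1 ≤ q)] {μ a b : Fin n → ℝ} {s c : Fin n → ℝ → ℝ}

/-- The sharp Poincaré inequality on the rectangle. -/
theorem sum_mul_norm_sobolevEmb_rpow_le (hq : q ≠ ⊤) (hq1 : 1 < q.toReal)
    (hs : ∀ i, IsDirichletProfile q.toReal (μ i) (a i) (b i) (s i) (c i))
    (g : W0sub q (stripDomain n 0 a b)) :
    (∑ i, μ i) * ‖SobolevEmb q (stripDomain n 0 a b) g‖ ^ q.toReal ≤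
      ‖SobolevGrad q (stripDomain n 0 a b) g‖ ^ q.toReal := by
  refine W0sub_induction (isClosed_mul_norm_rpow_le (∑ i, μ i)) (fun f u hu hfu => ?_) g.2
  have hf : f ∈ W0sub q (stripDomain n 0 a b) :=
    Submodule.le_topologicalClosure _ (Submodule.subset_span ⟨u, hu, hfu⟩)
  change (∑ i, μ i) * ‖SobolevEmb q (stripDomain n 0 a b) ⟨f, hf⟩‖ ^ q.toReal ≤
    ‖SobolevGrad q (stripDomain n 0 a b) ⟨f, hf⟩‖ ^ q.toReal
  have e1 : ∫ x, |f x 0| ^ q.toReal = ∫ x, |u x| ^ q.toReal :=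
    integral_congr_ae (by filter_upwards [hfu] with x hx; rw [hx]; rfl)
  have e2 : ∫ x, ∑ i : Fin n, |f x i.succ| ^ q.toReal =
      ∫ x, ∑ i : Fin n, |pder i u x| ^ q.toReal :=
    integral_congr_ae (by filter_upwards [hfu] with x hx; rw [hx]; rfl)
  rw [norm_sobolevEmb_rpow hq, norm_sobolevGrad_rpow hq, e1, e2, integral_finsetSum,
    Finset.sum_mul]
  · exact Finset.sum_le_sum fun i _ =>
      mul_integral_abs_rpow_le hq1 hs i hu.contDiff_one hu.2.1 hu.2.2
  · refine fun i _ => Continuous.integrable_of_hasCompactSupport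
      ((continuous_pder i hu.contDiff_one).abs.rpow_const fun _ => Or.inr (by linarith))
      ((hu.2.1.pder i).comp_left (g := fun t => |t| ^ q.toReal) ?_)
    simp [Real.zero_rpow (by linarith : q.toReal ≠ 0)]

/-- The product of the profiles minimizes the Rayleigh quotient on the rectangle. -/
theorem exists_minimizer_rayleigh {p : ℝ} (hq : q ≠ ⊤) (hqp : q.toReal = p) (hp : 1 < p)
    (hab : ∀ i, a i < b i)
    (hs : ∀ i, IsDirichletProfile p (μ i) (a i) (b i) (s i) (c i)) :
    ∃ f : W0sub q (stripDomain n 0 a b), f ≠ 0 ∧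
      (⇑(SobolevEmb q (stripDomain n 0 a b) f) =ᵐ[volume]
        (stripDomain n 0 a b).indicator fun x => ∏ j, s j (x j)) ∧
      ∀ g : W0sub q (stripDomain n 0 a b), g ≠ 0 →
        ‖SobolevGrad q (stripDomain n 0 a b) f‖ ^ p /
            ‖SobolevEmb q (stripDomain n 0 a b) f‖ ^ p ≤
          ‖SobolevGrad q (stripDomain n 0 a b) g‖ ^ p /
            ‖SobolevEmb q (stripDomain n 0 a b) g‖ ^ p := by
  subst hqp
  set D := stripDomain n 0 a b with hD
  set P : (Fin n → ℝ) → ℝ := fun x => ∏ j, s j (x j) with hP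
  have hr0 : q.toReal ≠ 0 := by linarith
  have hDo : IsOpen D := isOpen_stripDomain_zero a b
  have hDm : MeasurableSet D := hDo.measurableSet
  obtain ⟨f, hf, hfP⟩ := representsW0_prod_profile hq hs
  have hemb : ⇑(SobolevEmb q D ⟨f, hf⟩) =ᵐ[volume] D.indicator P := by
    filter_upwards [sobolevEmb_coeFn ⟨f, hf⟩, hfP] with x h1 h2
    rw [h1]
    change f x 0 = _
    rw [h2]
    rfl
  have hf0 : (⟨f, hf⟩ : W0sub q D) ≠ 0 := by
    intro h
    have h1 : ∀ᵐ x, x ∉ D := by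
      filter_upwards [hemb, Lp.coeFn_zero ℝ q (volume : Measure (Fin n → ℝ))] with x h2 h3 hx
      rw [h, map_zero, h3, indicator_of_mem hx] at h2
      exact (prod_profile_pos hs hx).ne h2
    have h2 : volume D = 0 := by simpa [ae_iff] using h1
    refine (hDo.measure_pos volume ⟨fun i => (a i + b i) / 2, ?_⟩).ne' h2
    exact mem_stripDomain_zero.2 fun i => ⟨by linarith [hab i], by linarith [hab i]⟩
  have hnorm : ∀ g : W0sub q D, g ≠ 0 → 0 < ‖SobolevEmb q D g‖ ^ q.toReal := fun g hg =>
    Real.rpow_pos_of_pos (norm_pos_iff.2 fun h => hg (sobolevEmb_injective (by rw [h, map_zero]))) _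
  have hE : ‖SobolevEmb q D ⟨f, hf⟩‖ ^ q.toReal = ∫ x in D, |P x| ^ q.toReal := by
    rw [norm_sobolevEmb_rpow hq, ← integral_indicator hDm]
    refine integral_congr_ae ?_
    filter_upwards [hfP] with x h
    change |f x 0| ^ _ = _
    rw [h]
    change |D.indicator P x| ^ q.toReal = _
    by_cases hx : x ∈ D <;> simp [hx, Real.zero_rpow hr0]
  have hG : ‖SobolevGrad q D ⟨f, hf⟩‖ ^ q.toReal =
      (∑ i, μ i) * ∫ x in D, |P x| ^ q.toReal := by
    have e : ‖SobolevGrad q D ⟨f, hf⟩‖ ^ q.toReal =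
        ∫ x in D, ∑ i, |pder i P x| ^ q.toReal := by
      rw [norm_sobolevGrad_rpow hq, ← integral_indicator hDm]
      refine integral_congr_ae ?_
      filter_upwards [hfP] with x h
      change ∑ i : Fin n, |f x i.succ| ^ _ = _
      rw [h]
      change ∑ i : Fin n, |D.indicator (pder i P) x| ^ q.toReal = _
      by_cases hx : x ∈ D <;> simp [hx, Real.zero_rpow hr0]
    obtain ⟨M, -, hM⟩ := exists_abs_pder_prod_profile_le hs
    rw [e, integral_finsetSum, Finset.sum_mul]
    · exact Finset.sum_congr rfl fun i _ => setIntegral_abs_pder_rpow hp hs i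
    · intro i _
      have hDfin : volume D < ⊤ :=
        (measure_mono (stripDomain_zero_subset_Icc a b)).trans_lt isCompact_Icc.measure_lt_top
      refine Integrable.mono' (integrableOn_const (C := M ^ q.toReal) hDfin.ne)
        (((continuousOn_pder_prod_profile hs i).aemeasurable hDm).abs.pow_const
          _).aestronglyMeasurable ?_
      filter_upwards [ae_restrict_mem hDm] with x hx
      rw [Real.norm_of_nonneg (Real.rpow_nonneg (abs_nonneg _) _)]
      exact Real.rpow_le_rpow (abs_nonneg _) (hM i x hx) (by linarith)
  refine ⟨⟨f, hf⟩, hf0, hemb, fun g hg => ?_⟩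
  rw [hG, ← hE, mul_div_cancel_right₀ _ (hnorm _ hf0).ne', le_div_iff₀ (hnorm g hg)]
  exact sum_mul_norm_sobolevEmb_rpow_le hq hp hs g

theorem prod_profile_eq_zero_of_mem_frontier {p : ℝ}
    (hs : ∀ i, IsDirichletProfile p (μ i) (a i) (b i) (s i) (c i)) {x : Fin n → ℝ}
    (hx : x ∈ frontier (stripDomain n 0 a b)) : ∏ j, s j (x j) = 0 := by
  rw [(isOpen_stripDomain_zero a b).frontier_eq] at hx
  exact prod_profile_eq_zero hs
    (closure_minimal (stripDomain_zero_subset_Icc a b) isClosed_Icc hx.1) hx.2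

/-- The product of the profiles is a weak solution of the pseudo-`p`-Laplacian equation. -/
theorem sum_integral_flux_mul_pder {p : ℝ}
    (hs : ∀ i, IsDirichletProfile p (μ i) (a i) (b i) (s i) (c i)) {φ : (Fin n → ℝ) → ℝ}
    (hφ : IsTestFun (stripDomain n 0 a b) φ) :
    ∑ i : Fin n, ∫ x in stripDomain n 0 a b,
        |pder i (fun x : Fin n → ℝ => ∏ j, s j (x j)) x| ^ (p - 2) *
          pder i (fun x : Fin n → ℝ => ∏ j, s j (x j)) x * pder i φ x =
      (∑ i, μ i) * ∫ x in stripDomain n 0 a b,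
        |∏ j, s j (x j)| ^ (p - 2) * (∏ j, s j (x j)) * φ x := by
  rw [Finset.sum_mul]
  refine Finset.sum_congr rfl fun i _ => ?_
  rw [integral_flux_mul_pder hs i hφ.contDiff_one hφ.2.1 hφ.2.2]
  congr 1
  refine setIntegral_congr_fun (isOpen_stripDomain_zero a b).measurableSet fun x hx => ?_
  have hpos := prod_profile_pos hs hx
  rw [abs_of_pos hpos, ← Real.rpow_add_one hpos.ne']
  congr 2
  ring

end Rectangle

/-- On the rectangle `R = ∏_{i=1}^n (aᵢ,bᵢ)`, the function
`u(x) = ∏ᵢ sin_p(π_p (xᵢ - aᵢ)/(bᵢ - aᵢ))` is a first eigenfunction of the Dirichlet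
pseudo-`p`-Laplacian: it minimizes the Rayleigh quotient over nonzero elements of
`W₀^{1,p}(R)`, vanishes on `∂R`, and satisfies `Δ̃_p u = λ̃_p |u|^{p-2} u` in the weak sense,
with `λ̃_p = π_p^p (p-1) ∑ᵢ (bᵢ-aᵢ)^{-p}`. -/
theorem first_eigenfunction_pseudo_p_laplacian_rectangle
    (n : ℕ) (p : ℝ) (hp : 1 < p)
    (a b : Fin n → ℝ) (hab : ∀ i : Fin n, a i < b i) :
    letI : Fact (1 ≤ ENNReal.ofReal p) := ⟨ENNReal.one_le_ofReal.mpr hp.le⟩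
    -- the function u and the first eigenvalue λ̃_p
    (fun u : (Fin n → ℝ) → ℝ => fun lam : ℝ =>
      -- u minimizes the Rayleigh quotient over nonzero elements of W₀^{1,p}(R)
      (∃ f : W0sub (ENNReal.ofReal p) (stripDomain n 0 a b), f ≠ 0 ∧
        (⇑(SobolevEmb (ENNReal.ofReal p) (stripDomain n 0 a b) f) =ᵐ[volume]
          (stripDomain n 0 a b).indicator u) ∧
        ∀ g : W0sub (ENNReal.ofReal p) (stripDomain n 0 a b), g ≠ 0 →
          ‖SobolevGrad (ENNReal.ofReal p) (stripDomain n 0 a b) f‖ ^ p /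
              ‖SobolevEmb (ENNReal.ofReal p) (stripDomain n 0 a b) f‖ ^ p ≤
            ‖SobolevGrad (ENNReal.ofReal p) (stripDomain n 0 a b) g‖ ^ p /
              ‖SobolevEmb (ENNReal.ofReal p) (stripDomain n 0 a b) g‖ ^ p) ∧
      -- Dirichlet boundary condition: u = 0 on ∂R
      (∀ x ∈ frontier (stripDomain n 0 a b), u x = 0) ∧
      -- the eigenvalue equation Δ̃_p u = λ̃_p |u|^{p-2} u, in the weak sense
      (∀ φ : (Fin n → ℝ) → ℝ, IsTestFun (stripDomain n 0 a b) φ →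
        ∑ i : Fin n, ∫ x in stripDomain n 0 a b,
            |pder i u x| ^ (p - 2) * pder i u x * pder i φ x =
          lam * ∫ x in stripDomain n 0 a b, |u x| ^ (p - 2) * u x * φ x))
    (fun x => ∏ i : Fin n, sinp p (piP p * (x i - a i) / (b i - a i)))
    (piP p ^ p * (p - 1) * ∑ i : Fin n, (b i - a i) ^ (-p)) := by
  have hq : (ENNReal.ofReal p).toReal = p := ENNReal.toReal_ofReal (by linarith)
  have : Fact (1 ≤ ENNReal.ofReal p) := ⟨ENNReal.one_le_ofReal.mpr hp.le⟩
  have hs : ∀ i, IsDirichletProfile p (piP p ^ p * (p - 1) * (b i - a i) ^ (-p)) (a i) (b i)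
      ((fun i t => sinp p (piP p * (t - a i) / (b i - a i))) i) _ := fun i =>
    isDirichletProfile_sinp hp (hab i)
  refine ⟨?_, fun x hx => prod_profile_eq_zero_of_mem_frontier hs hx, fun φ hφ => ?_⟩
  · have h := exists_minimizer_rayleigh (q := ENNReal.ofReal p)
      (s := fun i t => sinp p (piP p * (t - a i) / (b i - a i)))
      (μ := fun i => piP p ^ p * (p - 1) * (b i - a i) ^ (-p)) ENNReal.ofReal_ne_top hq hp hab hs
    exact h
  · rw [Finset.mul_sum]
    exact sum_integral_flux_mul_pder hs hφ
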